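/- arXiv:math/0703277 — 2 statements merged into one kernel-verified Lean document; each statement's English description precedes it below -/
import Mathlib

section
/- Let K be an algebraically closed field of characteristic 0 and g = R ⋉ n a finite-dimensional algebraic Lie algebra over K, with n the nilpotent radical, R = U ⊕ S a maximal reductive subalgebra where S = [R,R] is semisimple and U is the center of R (R acting semisimply on g via the adjoint action). Let ī_q : H^q(n,n)^R → H^q(g,g) be the maps induced by extension by zero. Then (ī₁ is surjective, ī₂ is bijective, and ī₃ is injective) if and only if H¹(n, g/n)^R = 0 = H²(n, g/n)^R and, in addition, either U = 0, or U ≠ 0 and g is complete (i.e. g has trivial center and every derivation of g is inner). -/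
section Stmt1

/-- Linearity of a raw map between modules. -/
def IsLinM (A : Type) [CommRing A] {M W : Type} [AddCommGroup M] [Module A M]
    [AddCommGroup W] [Module A W] (L : M → W) : Prop :=
  ∀ (a : A) (x y : M), L (a • x + y) = a • L x + L y

/-- Bilinearity of a raw map between modules. -/
def IsBilinM (A : Type) [CommRing A] {M W : Type} [AddCommGroup M] [Module A M]
    [AddCommGroup W] [Module A W] (f : M → M → W) : Prop :=
  (∀ (a : A) (x x' y : M), f (a • x + x') y = a • f x y + f x' y) ∧
  (∀ (a : A) (x y y' : M), f x (a • y + y') = a • f x y + f x y')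

/-- Trilinearity of a raw map. -/
def IsTrilinM (A : Type) [CommRing A] {M W : Type} [AddCommGroup M] [Module A M]
    [AddCommGroup W] [Module A W] (f : M → M → M → W) : Prop :=
  (∀ (a : A) (x x' y z : M), f (a • x + x') y z = a • f x y z + f x' y z) ∧
  (∀ (a : A) (x y y' z : M), f x (a • y + y') z = a • f x y z + f x y' z) ∧
  (∀ (a : A) (x y z z' : M), f x y (a • z + z') = a • f x y z + f x y z')

/-- Chevalley–Eilenberg differential `C¹ → C²` for the bracket `φ`. -/
def d1 {M : Type} [AddCommGroup M] (φ : M → M → M) (L : M → M) : M → M → M :=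
  fun x y => φ x (L y) - φ y (L x) - L (φ x y)

/-- Chevalley–Eilenberg differential `C² → C³` for the bracket `φ`. -/
def d2 {M : Type} [AddCommGroup M] (φ : M → M → M) (ψ : M → M → M) : M → M → M → M :=
  fun x y z =>
    φ x (ψ y z) - φ y (ψ x z) + φ z (ψ x y)
      - ψ (φ x y) z + ψ (φ x z) y - ψ (φ y z) x

/-- Chevalley–Eilenberg differential `C³ → C⁴` for the bracket `φ`. -/
def d3 {M : Type} [AddCommGroup M] (φ : M → M → M) (χ : M → M → M → M) :
    M → M → M → M → M :=
  fun x y z w =>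
    φ x (χ y z w) - φ y (χ x z w) + φ z (χ x y w) - φ w (χ x y z)
      - χ (φ x y) z w + χ (φ x z) y w - χ (φ x w) y z
      - χ (φ y z) x w + χ (φ y w) x z - χ (φ z w) x y

/-- Extension by zero `K^n → K^m` (first `n` coordinates). -/
def inclFun (A : Type) [CommRing A] (m n : ℕ) (w : Fin n → A) : Fin m → A :=
  fun k => if h : (k : ℕ) < n then w ⟨k, h⟩ else 0

/-- Restriction `K^m → K^n` to the first `n` coordinates. -/
def restFun (A : Type) [CommRing A] {m : ℕ} (n : ℕ) (hnm : n ≤ m) (v : Fin m → A) :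
    Fin n → A :=
  fun i => v (Fin.castLE hnm i)

/-- Left-normed iterated bracket. -/
def leftBrF {M : Type} [AddCommGroup M] (φ : M → M → M) : ℕ → (ℕ → M) → M
  | 0, x => x 0
  | (c + 1), x => φ (leftBrF φ c x) (x (c + 1))

set_option linter.unusedSectionVars false


section Whitehead
open LieAlgebra LieModule

lemma wh_perfect {K S : Type*} [Field K] [LieRing S] [LieAlgebra K S]
    [IsKilling K S] [FiniteDimensional K S] : (⁅(⊤ : LieIdeal K S), (⊤ : LieIdeal K S)⁆) = ⊤ := by
  set D : LieIdeal K S := ⁅(⊤ : LieIdeal K S), (⊤ : LieIdeal K S)⁆ with hD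
  have hc := LieIdeal.isCompl_killingCompl (K := K) (L := S) D
  set J := LieIdeal.killingCompl K S D
  have hJ : IsLieAbelian J := by
    rw [LieSubmodule.lie_abelian_iff_lie_self_eq_bot]
    rw [eq_bot_iff, ← hc.inf_eq_bot]
    exact le_inf (LieSubmodule.mono_lie le_top le_top) (LieSubmodule.lie_le_right J J)
  have : J = ⊥ := IsKilling.ideal_eq_bot_of_isLieAbelian J
  rw [this] at hc
  simpa using hc.sup_eq_top

lemma wh_casimir {K S M : Type*} [Field K] [CharZero K] [LieRing S] [LieAlgebra K S]
    [IsKilling K S] [FiniteDimensional K S]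
    [AddCommGroup M] [Module K M] [LieRingModule S M] [LieModule K S M] [FiniteDimensional K M]
    (A : LieSubmodule K S M) (hA : traceForm K S A ≠ 0) :
    ∃ C : Module.End K M, (∀ (s : S) (v : M), C ⁅s, v⁆ = ⁅s, C v⁆) ∧
      (∀ v, (∀ s : S, ⁅s, v⁆ ∈ A) → C v ∈ A) ∧
      (∀ k : ℕ, ∃ a ∈ A, (C ^ k) a ≠ 0) := by
  classical
  let β := traceForm K S A
  let I : LieIdeal K S :=
    { LinearMap.ker β with
      lie_mem := by
        intro x y hy
        have hy' : β y = 0 := hy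
        change β ⁅x, y⁆ = 0
        ext z
        have := traceForm_apply_lie_apply' K S A x y z
        change β ⁅x, y⁆ z = - β y ⁅x, z⁆ at this
        rw [this, hy']; simp }
  have hImem : ∀ x, x ∈ I ↔ β x = 0 := fun x => Iff.rfl
  have hc := LieIdeal.isCompl_killingCompl (K := K) (L := S) I
  set J := LieIdeal.killingCompl K S I
  let B : LinearMap.BilinForm K J := β.domRestrict₁₂ J.toSubmodule J.toSubmodule
  have hBapp : ∀ x y : J, B x y = β x y := fun x y => rfl
  have hsymm : ∀ x y, β x y = β y x := traceForm_comm K S A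
  have hBs : B.IsSymm := ⟨fun x y => hsymm _ _⟩
  have hB : B.Nondegenerate := by
    have key : ∀ x : J, (∀ y : J, B x y = 0) → x = 0 := by
      intro x hx
      have hxI : (x : S) ∈ I := by
        rw [hImem]
        ext z
        have hz : z ∈ I ⊔ J := by rw [hc.sup_eq_top]; trivial
        obtain ⟨z1, h1, z2, h2, rfl⟩ := (LieSubmodule.mem_sup _ _ _).mp hz
        have e1 : β x z1 = 0 := by rw [hsymm, (hImem _).mp h1]; rfl
        have e2 : β x z2 = 0 := hx ⟨z2, h2⟩
        simp [e1, e2]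
      have : (x : S) ∈ I ⊓ J := ⟨hxI, x.2⟩
      rw [hc.inf_eq_bot] at this
      exact Subtype.ext (by simpa using this)
    refine ⟨fun x hx => key x hx, fun x hx => key x (fun y => ?_)⟩
    rw [hBapp, hsymm]; exact hx y
  let b := Module.finBasis K J
  let b' := B.dualBasis hB b
  have hbb : ∀ i j, B (b i) (b' j) = if i = j then 1 else 0 :=
    LinearMap.BilinForm.apply_dualBasis_right hB hBs b
  have hbb' : ∀ i j, B (b' i) (b j) = if j = i then 1 else 0 :=
    LinearMap.BilinForm.apply_dualBasis_left hB b
  -- expansions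
  have ex1 : ∀ x : J, x = ∑ j, B x (b' j) • b j := by
    intro x
    conv_lhs => rw [← b.sum_repr x]
    refine Finset.sum_congr rfl fun j _ => ?_
    congr 1
    have := congrArg (fun z => B z (b' j)) (b.sum_repr x)
    simp only [map_sum, map_smul, LinearMap.sum_apply, LinearMap.smul_apply, hbb, smul_eq_mul,
      mul_ite, mul_one, mul_zero, Finset.sum_ite_eq', Finset.mem_univ, if_true] at this
    exact this
  have ex2 : ∀ x : J, x = ∑ j, B x (b j) • b' j := by
    intro x
    conv_lhs => rw [← b'.sum_repr x]
    refine Finset.sum_congr rfl fun j _ => ?_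
    congr 1
    exact LinearMap.BilinForm.dualBasis_repr_apply hB b x j
  let C : Module.End K M := ∑ i, toEnd K S M (b i) * toEnd K S M (b' i)
  have hC : ∀ v, C v = ∑ i, ⁅(b i : S), ⁅(b' i : S), v⁆⁆ := by
    intro v; simp [C]
  have hCA : ∀ v, (∀ s : S, ⁅s, v⁆ ∈ A) → C v ∈ A := by
    intro v hv
    rw [hC]
    exact sum_mem fun i _ => A.lie_mem (hv _)
  refine ⟨C, ?_, hCA, ?_⟩
  · intro s v
    rw [hC, hC, lie_sum]
    have h1 : ∀ i, ⁅s, (b i : S)⁆ = ∑ j, β ⁅s, (b i : S)⁆ (b' j) • (b j : S) := by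
      intro i
      have := congrArg (fun z : J => (z : S)) (ex1 ⟨⁅s, (b i : S)⁆, J.lie_mem (b i).2⟩)
      simpa [hBapp] using this
    have h2 : ∀ i, ⁅s, (b' i : S)⁆ = ∑ j, β ⁅s, (b' i : S)⁆ (b j) • (b' j : S) := by
      intro i
      have := congrArg (fun z : J => (z : S)) (ex2 ⟨⁅s, (b' i : S)⁆, J.lie_mem (b' i).2⟩)
      simpa [hBapp] using this
    have h3 : ∀ i j, β ⁅s, (b' i : S)⁆ (b j) = - β ⁅s, (b j : S)⁆ (b' i) := by
      intro i j
      rw [show β ⁅s, (b' i : S)⁆ (b j) = - β (b' i) ⁅s, (b j : S)⁆ from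
        traceForm_apply_lie_apply' K S A _ _ _, hsymm]
    have h4 : ∑ i, ⁅⁅s, (b i : S)⁆, ⁅(b' i : S), v⁆⁆ + ∑ i, ⁅(b i : S), ⁅⁅s, (b' i : S)⁆, v⁆⁆ = 0 := by
      have e1 : ∀ i, ⁅⁅s, (b i : S)⁆, ⁅(b' i : S), v⁆⁆
          = ∑ j, β ⁅s, (b i : S)⁆ (b' j) • ⁅(b j : S), ⁅(b' i : S), v⁆⁆ := by
        intro i; conv_lhs => rw [h1 i]
        simp [sum_lie]
      have e2 : ∀ i, ⁅(b i : S), ⁅⁅s, (b' i : S)⁆, v⁆⁆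
          = ∑ j, -(β ⁅s, (b j : S)⁆ (b' i) • ⁅(b i : S), ⁅(b' j : S), v⁆⁆) := by
        intro i; conv_lhs => rw [h2 i]
        simp [sum_lie, lie_sum, h3]
      simp_rw [e1, e2]
      rw [Finset.sum_comm, ← Finset.sum_add_distrib]
      refine Finset.sum_eq_zero fun i _ => ?_
      rw [← Finset.sum_add_distrib]
      refine Finset.sum_eq_zero fun j _ => ?_
      simp
    have h5 : ∀ i, ⁅s, ⁅(b i : S), ⁅(b' i : S), v⁆⁆⁆ = ⁅(b i : S), ⁅(b' i : S), ⁅s, v⁆⁆⁆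
        + (⁅⁅s, (b i : S)⁆, ⁅(b' i : S), v⁆⁆ + ⁅(b i : S), ⁅⁅s, (b' i : S)⁆, v⁆⁆) := by
      intro i
      rw [leibniz_lie s (b i : S), leibniz_lie s (b' i : S), lie_add]; abel
    simp_rw [h5]
    rw [Finset.sum_add_distrib, Finset.sum_add_distrib, h4, add_zero]
  · intro k
    by_contra hcon
    push Not at hcon
    let CA : Module.End K A := ∑ i, toEnd K S A (b i) * toEnd K S A (b' i)
    have hCA2 : ∀ a : A, ((CA a : A) : M) = C a := by
      intro a; rw [hC]; simp [CA]
    have hpow : ∀ (j : ℕ) (a : A), (((CA ^ j) a : A) : M) = (C ^ j) a := by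
      intro j
      induction j with
      | zero => intro a; simp
      | succ j ih => intro a; rw [pow_succ', pow_succ', Module.End.mul_apply, Module.End.mul_apply, hCA2, ih]
    have hnil : IsNilpotent CA := by
      refine ⟨k, ?_⟩
      ext a
      rw [hpow]; simpa using hcon a a.2
    have ht := (LinearMap.isNilpotent_trace_of_isNilpotent hnil).eq_zero
    have ht2 : LinearMap.trace K A CA = (Module.finrank K J : K) := by
      have : ∀ i, LinearMap.trace K A (toEnd K S A (b i) * toEnd K S A (b' i)) = 1 := by
        intro i
        have := hbb i i
        rw [if_pos rfl] at this
        exact this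
      simp [CA, map_sum, this]
    rw [ht2] at ht
    have hf : Module.finrank K J = 0 := by exact_mod_cast ht
    apply hA
    have hsub := Module.finrank_zero_iff.mp hf
    have hJ : J = ⊥ := by
      rw [eq_bot_iff]; intro x hx
      have := Subsingleton.elim (⟨x, hx⟩ : J) 0
      simpa using congrArg Subtype.val this
    rw [hJ] at hc
    have hI : I = ⊤ := by simpa using hc.sup_eq_top
    ext x y
    have : x ∈ I := by rw [hI]; trivial
    have := (hImem x).mp this
    change β x y = 0
    rw [this]; rfl

/-- Whitehead's first lemma in a convenient form. -/
theorem whitehead_one {K S M : Type*} [Field K] [CharZero K] [LieRing S] [LieAlgebra K S]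
    [IsKilling K S] [FiniteDimensional K S]
    [AddCommGroup M] [Module K M] [LieRingModule S M] [LieModule K S M] [FiniteDimensional K M]
    (d : ℕ) : ∀ (A : LieSubmodule K S M), Module.finrank K A ≤ d →
      ∀ y : M, (∀ s : S, ⁅s, y⁆ ∈ A) → ∃ a ∈ A, ∀ s : S, ⁅s, y - a⁆ = 0 := by
  induction d with
  | zero =>
    intro A hA y hy
    have hsub := Module.finrank_zero_iff.mp (Nat.le_zero.mp hA)
    refine ⟨0, A.zero_mem, fun s => ?_⟩
    have := Subsingleton.elim (⟨_, hy s⟩ : A) 0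
    rw [sub_zero]
    simpa using congrArg Subtype.val this
  | succ d ih =>
    intro A hA y hy
    by_cases ht : traceForm K S A = 0
    · -- the trace form vanishes: `S = [S,S]` acts nilpotently
      refine ⟨0, A.zero_mem, fun s => ?_⟩
      rw [sub_zero]
      have hn := isNilpotent_derivedSeries_of_traceForm_eq_zero ht
      have hD : derivedSeries K S 1 = ⊤ := wh_perfect
      have hnS : LieModule.IsNilpotent S A := by
        rw [isNilpotent_iff_forall' (R := K)] at hn ⊢
        intro x
        exact hn ⟨x, by rw [hD]; trivial⟩
      obtain ⟨k, hk⟩ := (LieModule.isNilpotent_iff K S A).mp hnS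
      have key : ∀ k, ∀ s : S, (⟨⁅s, y⁆, hy s⟩ : A) ∈ lowerCentralSeries K S A k := by
        intro k
        induction k with
        | zero => intro s; simp
        | succ k ihk =>
          intro s
          have hs : s ∈ (⁅(⊤ : LieIdeal K S), (⊤ : LieIdeal K S)⁆ : LieIdeal K S) := by
            rw [wh_perfect]; trivial
          rw [← LieSubmodule.mem_toSubmodule, LieSubmodule.lieIdeal_oper_eq_linear_span'] at hs
          induction hs using Submodule.span_induction with
          | mem x hx =>
            obtain ⟨p, -, q, -, rfl⟩ := hx
            have e : (⟨⁅⁅p, q⁆, y⁆, hy _⟩ : A) = ⁅p, (⟨⁅q, y⁆, hy q⟩ : A)⁆ - ⁅q, (⟨⁅p, y⁆, hy p⟩ : A)⁆ := by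
              apply Subtype.ext
              simp
            rw [e, lowerCentralSeries_succ]
            exact sub_mem (LieSubmodule.lie_mem_lie trivial (ihk q))
              (LieSubmodule.lie_mem_lie trivial (ihk p))
          | zero =>
            have e : (⟨⁅(0 : S), y⁆, hy _⟩ : A) = 0 := Subtype.ext (by simp)
            rw [e]; exact zero_mem _
          | add p q _ _ hp hq =>
            have e : (⟨⁅p + q, y⁆, hy _⟩ : A) = ⟨⁅p, y⁆, hy p⟩ + ⟨⁅q, y⁆, hy q⟩ :=
              Subtype.ext (by simp)
            rw [e]; exact add_mem hp hq
          | smul c p _ hp =>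
            have e : (⟨⁅c • p, y⁆, hy _⟩ : A) = c • ⟨⁅p, y⁆, hy p⟩ := Subtype.ext (by simp)
            rw [e]; exact (lowerCentralSeries K S A (k + 1)).smul_mem c hp
      have := key k s
      rw [hk] at this
      simpa using congrArg Subtype.val ((LieSubmodule.mem_bot _).mp this)
    · obtain ⟨C, hCs, hCA, hCn⟩ := wh_casimir A ht
      have hCpow : ∀ (k : ℕ) (s : S) (v : M), (C ^ k) ⁅s, v⁆ = ⁅s, (C ^ k) v⁆ := by
        intro k
        induction k with
        | zero => intro s v; simp
        | succ k ihk => intro s v; simp only [pow_succ', Module.End.mul_apply, ihk, hCs]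
      have hCAA : ∀ a ∈ A, C a ∈ A := fun a ha => hCA a fun s => A.lie_mem ha
      have hCpA : ∀ (k : ℕ), ∀ a ∈ A, (C ^ k) a ∈ A := by
        intro k
        induction k with
        | zero => intro a ha; simpa
        | succ k ihk => intro a ha; rw [pow_succ', Module.End.mul_apply]; exact hCAA _ (ihk a ha)
      let CA : Module.End K A := C.restrict hCAA
      have hpow : ∀ (j : ℕ) (a : A), (((CA ^ j) a : A) : M) = (C ^ j) a := by
        intro j
        induction j with
        | zero => intro a; simp
        | succ j ih =>
          intro a
          rw [pow_succ', pow_succ', Module.End.mul_apply, Module.End.mul_apply, ← ih]; rfl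
      obtain ⟨k, hk⟩ := (LinearMap.eventually_isCompl_ker_pow_range_pow CA).exists_forall_of_atTop
      have hc := hk (k + 1) (by omega)
      have hty : (C ^ (k + 1)) y ∈ A := by
        rw [pow_succ, Module.End.mul_apply]; exact hCpA k _ (hCA y hy)
      obtain ⟨z, hz, w, hw, hzw⟩ := Submodule.mem_sup.mp
        (hc.sup_eq_top ▸ Submodule.mem_top : (⟨(C ^ (k + 1)) y, hty⟩ : A) ∈ _)
      obtain ⟨w', rfl⟩ := hw
      have hzw' : (z : M) + (C ^ (k + 1)) w' = (C ^ (k + 1)) y := by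
        have := congrArg Subtype.val hzw
        simpa [hpow] using this
      have hz' : (C ^ (k + 1)) (z : M) = 0 := by
        rw [← hpow, LinearMap.mem_ker.mp hz]; rfl
      have hy' : (C ^ ((k + 1) + (k + 1))) (y - w') = 0 := by
        rw [pow_add, Module.End.mul_apply, map_sub, ← hzw', add_sub_cancel_right, hz']
      let A0 : LieSubmodule K S M :=
        { A.toSubmodule ⊓ LinearMap.ker (C ^ ((k + 1) + (k + 1))) with
          lie_mem := by
            rintro x v ⟨h1, h2⟩
            refine ⟨A.lie_mem h1, ?_⟩
            change (C ^ ((k + 1) + (k + 1))) ⁅x, v⁆ = 0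
            rw [hCpow, LinearMap.mem_ker.mp h2, lie_zero] }
      have hA0 : ∀ v, v ∈ A0 ↔ v ∈ A ∧ (C ^ ((k + 1) + (k + 1))) v = 0 := fun v => Iff.rfl
      have hlt : A0.toSubmodule < A.toSubmodule := by
        refine lt_of_le_of_ne (fun v hv => ((hA0 v).mp hv).1) fun he => ?_
        obtain ⟨a, ha, hne⟩ := hCn ((k + 1) + (k + 1))
        have : a ∈ A0.toSubmodule := by rw [he]; exact ha
        exact hne ((hA0 a).mp this).2
      have hfl : Module.finrank K A0 < Module.finrank K A := Submodule.finrank_lt_finrank_of_lt hlt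
      obtain ⟨a, ha, hay⟩ := ih A0 (by omega) (y - w') (fun s => (hA0 _).mpr ⟨by
        rw [lie_sub]; exact sub_mem (hy s) (A.lie_mem w'.2), by rw [hCpow, hy', lie_zero]⟩)
      refine ⟨w' + a, add_mem w'.2 ((hA0 a).mp ha).1, fun s => ?_⟩
      rw [← sub_sub]; exact hay s

/-- Lifting of invariants for a reductive family acting on a module: `S` is a semisimple
subalgebra and the elements of `U` are central and act without nilpotent part. -/
theorem lift_inv {K V M : Type*} [Field K] [CharZero K] [LieRing V] [LieAlgebra K V]
    [FiniteDimensional K V] (S : LieSubalgebra K V) [IsKilling K S] (U : Set V)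
    (hUU : ∀ u ∈ U, ∀ u' ∈ U, ⁅u, u'⁆ = 0) (hUS : ∀ u ∈ U, ∀ s ∈ S, ⁅u, s⁆ = 0)
    [AddCommGroup M] [Module K M] [LieRingModule V M] [LieModule K V M] [FiniteDimensional K M]
    (hss : ∀ u ∈ U, ∀ v : M, ⁅u, ⁅u, v⁆⁆ = 0 → ⁅u, v⁆ = 0) (d : ℕ) :
    ∀ (A : Submodule K M), Module.finrank K A ≤ d →
      (∀ u ∈ U, ∀ a ∈ A, ⁅u, a⁆ ∈ A) → (∀ s ∈ S, ∀ a ∈ A, ⁅s, a⁆ ∈ A) →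
      ∀ y : M, (∀ u ∈ U, ⁅u, y⁆ ∈ A) → (∀ s ∈ S, ⁅s, y⁆ ∈ A) →
      ∃ a ∈ A, (∀ u ∈ U, ⁅u, y - a⁆ = 0) ∧ (∀ s ∈ S, ⁅s, y - a⁆ = 0) := by
  have comU : ∀ u ∈ U, ∀ u' ∈ U, ∀ v : M, ⁅u, ⁅u', v⁆⁆ = ⁅u', ⁅u, v⁆⁆ := by
    intro u hu u' hu' v; rw [leibniz_lie, hUU u hu u' hu']; simp
  have comS : ∀ u ∈ U, ∀ u' ∈ S, ∀ v : M, ⁅u, ⁅u', v⁆⁆ = ⁅u', ⁅u, v⁆⁆ := by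
    intro u hu u' hu' v; rw [leibniz_lie, hUS u hu u' hu']; simp
  induction d with
  | zero =>
    intro A hA _ _ y hu hs
    have hsub := Module.finrank_zero_iff.mp (Nat.le_zero.mp hA)
    have h0 : ∀ v ∈ A, v = 0 := fun v hv => by
      have := Subsingleton.elim (⟨v, hv⟩ : A) 0
      simpa using congrArg Subtype.val this
    exact ⟨0, A.zero_mem, fun u h => by rw [sub_zero]; exact h0 _ (hu u h),
      fun u h => by rw [sub_zero]; exact h0 _ (hs u h)⟩
  | succ d ih =>
    intro A hA hAU hAS y hyU hyS
    by_cases htriv : ∀ u ∈ U, ∀ a ∈ A, ⁅u, a⁆ = 0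
    · let A' : LieSubmodule K S M := { A with lie_mem := fun {x v} hv => hAS x x.2 v hv }
      obtain ⟨a, ha, h⟩ := whitehead_one (K := K) (S := S) (M := M) _ A' le_rfl y
        (fun s => hyS s s.2)
      refine ⟨a, ha, fun u hu => ?_, fun s hs => h ⟨s, hs⟩⟩
      rw [lie_sub, htriv u hu a ha, sub_zero]
      exact hss u hu y (htriv u hu _ (hyU u hu))
    · push Not at htriv
      obtain ⟨u, hu, a0, ha0, hne⟩ := htriv
      let T : Module.End K A := (toEnd K V M u).restrict (fun a ha => hAU u hu a ha)
      have hT : ∀ a : A, ((T a : A) : M) = ⁅u, (a : M)⁆ := fun a => rfl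
      have hdis : Disjoint (LinearMap.ker T) (LinearMap.range T) := by
        rw [Submodule.disjoint_def]
        rintro x hx ⟨z, rfl⟩
        apply Subtype.ext
        have h1 : ⁅u, ⁅u, (z : M)⁆⁆ = 0 := by
          rw [← hT, ← hT, LinearMap.mem_ker.mp hx]; rfl
        exact hss u hu _ h1
      have hcomp : LinearMap.ker T ⊔ LinearMap.range T = ⊤ := by
        apply Submodule.eq_top_of_disjoint _ _ _ hdis
        have := LinearMap.finrank_range_add_finrank_ker T
        omega
      obtain ⟨z, hz, w, hw, hzw⟩ := Submodule.mem_sup.mp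
        (hcomp ▸ Submodule.mem_top : (⟨⁅u, y⁆, hyU u hu⟩ : A) ∈ _)
      obtain ⟨w', rfl⟩ := hw
      have hzw' : (z : M) + ⁅u, (w' : M)⁆ = ⁅u, y⁆ := by
        simpa [hT] using congrArg Subtype.val hzw
      have hz' : ⁅u, (z : M)⁆ = 0 := by rw [← hT, LinearMap.mem_ker.mp hz]; rfl
      have hy' : ⁅u, y - w'⁆ = 0 := by
        apply hss u hu
        rw [lie_sub u y, ← hzw', add_sub_cancel_right, hz']
      let A0 : Submodule K M := A ⊓ LinearMap.ker (toEnd K V M u)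
      have hA0 : ∀ v, v ∈ A0 ↔ v ∈ A ∧ ⁅u, v⁆ = 0 := fun v => Iff.rfl
      have hlt : A0 < A := by
        refine lt_of_le_of_ne (fun v hv => hv.1) fun he => ?_
        have : a0 ∈ A0 := by rw [he]; exact ha0
        exact hne ((hA0 a0).mp this).2
      have hfl : Module.finrank K A0 < Module.finrank K A := Submodule.finrank_lt_finrank_of_lt hlt
      obtain ⟨a, ha, h1, h2⟩ := ih A0 (by omega)
        (fun u' hu' a ha => (hA0 _).mpr ⟨hAU u' hu' a ((hA0 a).mp ha).1, by
          rw [comU u hu u' hu', ((hA0 a).mp ha).2, lie_zero]⟩)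
        (fun u' hu' a ha => (hA0 _).mpr ⟨hAS u' hu' a ((hA0 a).mp ha).1, by
          rw [comS u hu u' hu', ((hA0 a).mp ha).2, lie_zero]⟩)
        (y - w')
        (fun u' hu' => (hA0 _).mpr ⟨by
          rw [lie_sub]; exact sub_mem (hyU u' hu') (hAU u' hu' _ w'.2), by
          rw [comU u hu u' hu', hy', lie_zero]⟩)
        (fun u' hu' => (hA0 _).mpr ⟨by
          rw [lie_sub]; exact sub_mem (hyS u' hu') (hAS u' hu' _ w'.2), by
          rw [comS u hu u' hu', hy', lie_zero]⟩)
      refine ⟨w' + a, add_mem w'.2 ((hA0 a).mp ha).1, fun s hs => ?_, fun s hs => ?_⟩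
      · rw [← sub_sub]; exact h1 s hs
      · rw [← sub_sub]; exact h2 s hs

end Whitehead


structure RS (K V N : Type) [Field K] [LieRing V] [LieAlgebra K V] [AddCommGroup N]
    [Module K N] where
  i : N →ₗ[K] V
  p : V →ₗ[K] N
  U : Set V
  D : Submodule K V
  pi : ∀ x, p (i x) = x
  hid : ∀ (x : V) (y : N), i (p ⁅x, i y⁆) = ⁅x, i y⁆
  hR : ∀ r s : V, p r = 0 → p s = 0 → p ⁅r, s⁆ = 0
  hU : ∀ u : V, u ∈ U ↔ (p u = 0 ∧ ∀ s : V, p s = 0 → ⁅u, s⁆ = 0)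
  hD : D = Submodule.span K {z | ∃ u v : V, p u = 0 ∧ p v = 0 ∧ z = ⁅u, v⁆}
  hUD : ∀ r : V, p r = 0 → ∃ u ∈ U, ∃ s ∈ D, r = u + s
  hUD0 : ∀ x ∈ U, x ∈ D → x = 0
  hDs : ∀ W : Submodule K V, W ≤ D → (∀ s ∈ D, ∀ w ∈ W, ⁅s, w⁆ ∈ W) →
      (∀ w ∈ W, ∀ w' ∈ W, ⁅w, w'⁆ = 0) → W = ⊥
  hss : ∀ W : Submodule K V, (∀ r : V, p r = 0 → ∀ x ∈ W, ⁅r, x⁆ ∈ W) →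
      ∃ W' : Submodule K V, IsCompl W W' ∧ ∀ r : V, p r = 0 → ∀ x ∈ W', ⁅r, x⁆ ∈ W'

namespace RS
open LieAlgebra LieModule

section
variable {K V N : Type} [Field K] [CharZero K] [LieRing V] [LieAlgebra K V]
    [FiniteDimensional K V] [AddCommGroup N] [Module K N] (H : RS K V N)

lemma D_sub {x : V} (hx : x ∈ H.D) : H.p x = 0 := by
  rw [H.hD] at hx
  induction hx using Submodule.span_induction with
  | mem x h => obtain ⟨u, v, hu, hv, rfl⟩ := h; exact H.hR u v hu hv
  | zero => simp
  | add x y _ _ hx hy => simp [hx, hy]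
  | smul a x _ hx => simp [hx]

lemma lie_D {x y : V} (hx : H.p x = 0) (hy : H.p y = 0) : ⁅x, y⁆ ∈ H.D := by
  rw [H.hD]; exact Submodule.subset_span ⟨x, y, hx, hy, rfl⟩

def S : LieSubalgebra K V :=
  { H.D with lie_mem' := fun hx hy => H.lie_D (H.D_sub hx) (H.D_sub hy) }

lemma mem_S {x : V} : x ∈ H.S ↔ x ∈ H.D := Iff.rfl

lemma killing : IsKilling K H.S := by
  have : HasTrivialRadical K H.S := by
    rw [LieAlgebra.hasTrivialRadical_iff_no_abelian_ideals]
    intro I hI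
    have h := H.hDs (I.toSubmodule.map H.S.toSubmodule.subtype) ?_ ?_ ?_
    · rw [eq_bot_iff]
      intro x hx
      have h1 : (x : V) ∈ I.toSubmodule.map H.S.toSubmodule.subtype := ⟨x, hx, rfl⟩
      rw [h, Submodule.mem_bot] at h1
      exact (LieSubmodule.mem_bot x).2 (Subtype.ext h1)
    · rintro _ ⟨x, hx, rfl⟩
      exact x.2
    · rintro s hs _ ⟨x, hx, rfl⟩
      exact ⟨⁅(⟨s, hs⟩ : H.S), x⁆, I.lie_mem hx, rfl⟩
    · rintro _ ⟨x, hx, rfl⟩ _ ⟨y, hy, rfl⟩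
      have h2 : ⁅(⟨x, hx⟩ : I), (⟨y, hy⟩ : I)⁆ = 0 := hI.trivial _ _
      exact congrArg (fun z : I => ((z : H.S) : V)) h2
  infer_instance

lemma ss_ker {u : V} (hu : u ∈ H.U) (c : K) (x : V)
    (hx : ⁅u, ⁅u, x⁆ - c • x⁆ - c • (⁅u, x⁆ - c • x) = 0) : ⁅u, x⁆ - c • x = 0 := by
  have hu' := (H.hU u).1 hu
  let T : V →ₗ[K] V := (LieAlgebra.ad K V u : V →ₗ[K] V) - c • LinearMap.id
  have hT : ∀ y, T y = ⁅u, y⁆ - c • y := fun y => by simp [T]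
  have hTr : ∀ r : V, H.p r = 0 → ∀ y, T ⁅r, y⁆ = ⁅r, T y⁆ := by
    intro r hr y
    rw [hT, hT, leibniz_lie, hu'.2 r hr]
    simp
  obtain ⟨W', hW, hst⟩ := H.hss (LinearMap.ker T) (by
    intro r hr y hy
    rw [LinearMap.mem_ker] at hy ⊢
    rw [hTr r hr, hy, lie_zero])
  obtain ⟨a, ha, b, hb, rfl⟩ := Submodule.mem_sup.1 (hW.sup_eq_top ▸ Submodule.mem_top : x ∈ _)
  rw [LinearMap.mem_ker] at ha
  rw [← hT, ← hT] at hx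
  rw [← hT]
  rw [map_add, ha, zero_add] at hx ⊢
  have h1 : T b ∈ W' := by
    rw [hT]; exact sub_mem (hst u hu'.1 b hb) (W'.smul_mem c hb)
  exact Submodule.disjoint_def.1 hW.disjoint _ hx h1

lemma eig_span [IsAlgClosed K] {u : V} (hu : u ∈ H.U) :
    Submodule.span K {x : V | ∃ c : K, ⁅u, x⁆ = c • x} = ⊤ := by
  have hu' := (H.hU u).1 hu
  obtain ⟨W', hW, hst⟩ := H.hss (Submodule.span K {x : V | ∃ c : K, ⁅u, x⁆ = c • x}) (by
    intro r hr y hy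
    induction hy using Submodule.span_induction with
    | mem x h =>
      obtain ⟨c, hc⟩ := h
      apply Submodule.subset_span
      refine ⟨c, ?_⟩
      rw [leibniz_lie, hu'.2 r hr, hc]; simp
    | zero => simp
    | add x y _ _ hx hy => rw [lie_add]; exact add_mem hx hy
    | smul a x _ hx => rw [lie_smul]; exact Submodule.smul_mem _ _ hx)
  have hb : W' = ⊥ := by
    by_contra hne
    have : Nontrivial W' := Submodule.nontrivial_iff_ne_bot.2 hne
    let T : W' →ₗ[K] W' := (LieAlgebra.ad K V u : V →ₗ[K] V).restrict
      (fun x hx => hst u hu'.1 x hx)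
    obtain ⟨c, hc⟩ := Module.End.exists_eigenvalue T
    obtain ⟨v, hv⟩ := hc.exists_hasEigenvector
    have h1 : ⁅u, (v : V)⁆ = c • (v : V) := by
      have := congrArg Subtype.val hv.apply_eq_smul
      exact this
    have h2 := Submodule.disjoint_def.1 hW.disjoint (v : V)
      (Submodule.subset_span ⟨c, h1⟩) v.2
    exact hv.2 (Subtype.ext h2)
  have := hW.sup_eq_top
  rwa [hb, sup_bot_eq] at this

lemma hss1 [IsAlgClosed K] {u : V} (hu : u ∈ H.U) (f : V →ₗ[K] V) (hf : ⁅u, ⁅u, f⁆⁆ = 0) :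
    ⁅u, f⁆ = 0 := by
  refine LinearMap.ext_on (H.eig_span hu) ?_
  rintro x ⟨c, hc⟩
  have h := LinearMap.congr_fun hf x
  simp only [LieHom.lie_apply, hc, map_smul, LinearMap.zero_apply] at h ⊢
  exact H.ss_ker hu c (f x) h

lemma hss2 [IsAlgClosed K] {u : V} (hu : u ∈ H.U) (f : V →ₗ[K] V →ₗ[K] V)
    (hf : ⁅u, ⁅u, f⁆⁆ = 0) : ⁅u, f⁆ = 0 := by
  refine LinearMap.ext_on (H.eig_span hu) ?_
  rintro x ⟨c, hc⟩
  refine LinearMap.ext_on (H.eig_span hu) ?_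
  rintro y ⟨e, he⟩
  have h := LinearMap.congr_fun (LinearMap.congr_fun hf x) y
  simp only [LieHom.lie_apply, hc, he, map_smul, LinearMap.zero_apply, LinearMap.smul_apply,
    LinearMap.sub_apply] at h ⊢
  have := H.ss_ker hu (e + c) (f x y) (by rw [← h]; simp only [lie_sub, lie_smul]; module)
  rw [← this]; module

lemma avg {M : Type} [AddCommGroup M] [Module K M] [LieRingModule V M]
    [LieModule K V M] [FiniteDimensional K M]
    (hss : ∀ u ∈ H.U, ∀ v : M, ⁅u, ⁅u, v⁆⁆ = 0 → ⁅u, v⁆ = 0) (A : Submodule K M)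
    (hA : ∀ r : V, H.p r = 0 → ∀ a ∈ A, ⁅r, a⁆ ∈ A) (y : M) (hy : ∀ r : V, H.p r = 0 → ⁅r, y⁆ ∈ A) :
    ∃ a ∈ A, ∀ r : V, H.p r = 0 → ⁅r, y - a⁆ = 0 := by
  have := H.killing
  have hU : ∀ u ∈ H.U, H.p u = 0 := fun u hu => ((H.hU u).1 hu).1
  obtain ⟨a, ha, h1, h2⟩ := lift_inv H.S H.U
    (fun u hu u' hu' => ((H.hU u).1 hu).2 u' (hU u' hu'))
    (fun u hu s hs => ((H.hU u).1 hu).2 s (H.D_sub hs)) hss _ A le_rfl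
    (fun u hu => hA u (hU u hu)) (fun s hs => hA s (H.D_sub hs)) y
    (fun u hu => hy u (hU u hu)) (fun s hs => hy s (H.D_sub hs))
  refine ⟨a, ha, fun r hr => ?_⟩
  obtain ⟨u, hu, s, hs, rfl⟩ := H.hUD r hr
  rw [add_lie, h1 u hu, h2 s hs, add_zero]

end
end RS
namespace RS
section
variable {K V N : Type} [Field K] [CharZero K] [LieRing V] [LieAlgebra K V]
    [FiniteDimensional K V] [AddCommGroup N] [Module K N] (H : RS K V N)

/-- The bracket as a plain function. -/
abbrev lb (x y : V) : V := ⁅x, y⁆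

def br (x y : N) : N := H.p ⁅H.i x, H.i y⁆
def dl (r : V) (x : N) : N := H.p ⁅r, H.i x⁆
def q : V →ₗ[K] V := LinearMap.id - H.i ∘ₗ H.p

lemma i_br (x y : N) : H.i (H.br x y) = ⁅H.i x, H.i y⁆ := H.hid _ _
lemma i_dl (r : V) (x : N) : H.i (H.dl r x) = ⁅r, H.i x⁆ := H.hid _ _
lemma q_apply (x : V) : H.q x = x - H.i (H.p x) := rfl
lemma p_q (x : V) : H.p (H.q x) = 0 := by simp [q_apply, H.pi]
lemma dec (x : V) : x = H.q x + H.i (H.p x) := by simp [q_apply]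
lemma q_i (x : N) : H.q (H.i x) = 0 := by simp [q_apply, H.pi]
lemma q_R {r : V} (hr : H.p r = 0) : H.q r = r := by simp [q_apply, hr]
lemma q_lie_i (x : V) (y : N) : H.q ⁅x, H.i y⁆ = 0 := by rw [← H.i_dl, q_i]
lemma q_i_lie (x : V) (y : N) : H.q ⁅H.i y, x⁆ = 0 := by
  rw [← lie_skew, map_neg, q_lie_i, neg_zero]
lemma q_lie (x y : V) : H.q ⁅x, y⁆ = ⁅H.q x, H.q y⁆ := by
  conv_lhs => rw [H.dec x, H.dec y]
  rw [add_lie, lie_add, map_add, map_add, q_lie_i, q_i_lie,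
    H.q_R (H.hR _ _ (H.p_q x) (H.p_q y))]
  simp
lemma q_lie_R {r : V} (hr : H.p r = 0) (x : V) : H.q ⁅r, x⁆ = ⁅r, H.q x⁆ := by
  rw [q_lie, H.q_R hr]
lemma p_lie_R {r : V} (hr : H.p r = 0) (x : V) : H.p ⁅r, x⁆ = H.dl r (H.p x) := by
  conv_lhs => rw [H.dec x]
  rw [lie_add, map_add, H.hR _ _ hr (H.p_q x), zero_add]; rfl
lemma i_inj {x y : N} (h : H.i x = H.i y) : x = y := by rw [← H.pi x, h, H.pi]
lemma p_eq {x : V} {y : N} (h : x = H.i y) : H.p x = y := by rw [h, H.pi]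

lemma avg1 [IsAlgClosed K] (L : V →ₗ[K] V) (hL : ∀ x y, L ⁅x, y⁆ = ⁅L x, y⁆ + ⁅x, L y⁆) :
    ∃ (y : V) (L' : V →ₗ[K] V), (∀ x, L x = L' x + ⁅y, x⁆) ∧
      (∀ x y, L' ⁅x, y⁆ = ⁅L' x, y⁆ + ⁅x, L' y⁆) ∧
      (∀ r, H.p r = 0 → ∀ x, ⁅r, L' x⁆ = L' ⁅r, x⁆) := by
  obtain ⟨a, ⟨y, rfl⟩, ha⟩ := H.avg (M := V →ₗ[K] V) (fun u hu => H.hss1 hu)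
    (LinearMap.range (LieAlgebra.ad K V : V →ₗ[K] (V →ₗ[K] V)))
    (by
      rintro r hr _ ⟨y, rfl⟩
      refine ⟨⁅r, y⁆, LinearMap.ext fun x => ?_⟩
      simp [LieHom.lie_apply])
    L
    (by
      rintro r hr
      refine ⟨- L r, LinearMap.ext fun x => ?_⟩
      simp [LieHom.lie_apply, hL])
  refine ⟨y, L - (LieAlgebra.ad K V y : V →ₗ[K] V), fun x => by simp, fun x z => ?_,
    fun r hr x => ?_⟩
  · simp only [LinearMap.sub_apply, hL, LieAlgebra.ad_apply, lie_sub, sub_lie, leibniz_lie y]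
    abel
  · have := LinearMap.congr_fun (ha r hr) x
    rw [LieHom.lie_apply, LinearMap.zero_apply, sub_eq_zero] at this
    exact this

lemma d1_lie (L : V →ₗ[K] V) (r x y : V) : d1 lb (⁅r, L⁆ : V →ₗ[K] V) x y =
    ⁅r, d1 lb L x y⁆ - d1 lb L ⁅r, x⁆ y - d1 lb L x ⁅r, y⁆ := by
  simp only [d1, lb, LieHom.lie_apply, lie_sub, leibniz_lie r, map_add]
  abel

lemma d2_lie (P : V →ₗ[K] V →ₗ[K] V) (r x y z : V) :
    d2 lb (fun a b => (⁅r, P⁆ : V →ₗ[K] V →ₗ[K] V) a b) x y z =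
    ⁅r, d2 lb (fun a b => P a b) x y z⁆ - d2 lb (fun a b => P a b) ⁅r, x⁆ y z
      - d2 lb (fun a b => P a b) x ⁅r, y⁆ z - d2 lb (fun a b => P a b) x y ⁅r, z⁆ := by
  simp only [d2, lb, LieHom.lie_apply, lie_sub, leibniz_lie r, map_add, lie_add,
    LinearMap.sub_apply, LinearMap.add_apply]
  abel

lemma d1_add (L L' : V →ₗ[K] V) (x y : V) :
    d1 lb (L + L' : V →ₗ[K] V) x y = d1 lb L x y + d1 lb L' x y := by
  simp only [d1, lb, LinearMap.add_apply, lie_add]; abel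
lemma d1_sub (L L' : V →ₗ[K] V) (x y : V) :
    d1 lb (L - L' : V →ₗ[K] V) x y = d1 lb L x y - d1 lb L' x y := by
  simp only [d1, lb, LinearMap.sub_apply, lie_sub]; abel
lemma d1_smul (c : K) (L : V →ₗ[K] V) (x y : V) :
    d1 lb (c • L : V →ₗ[K] V) x y = c • d1 lb L x y := by
  simp only [d1, lb, LinearMap.smul_apply, lie_smul, smul_sub]
lemma d2_add (L L' : V →ₗ[K] V →ₗ[K] V) (x y z : V) :
    d2 lb (fun a b => (L + L') a b) x y z
      = d2 lb (fun a b => L a b) x y z + d2 lb (fun a b => L' a b) x y z := by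
  simp only [d2, lb, LinearMap.add_apply, lie_add]; abel
lemma d2_sub (L L' : V →ₗ[K] V →ₗ[K] V) (x y z : V) :
    d2 lb (fun a b => (L - L') a b) x y z
      = d2 lb (fun a b => L a b) x y z - d2 lb (fun a b => L' a b) x y z := by
  simp only [d2, lb, LinearMap.sub_apply, lie_sub]; abel
lemma d2_smul (c : K) (L : V →ₗ[K] V →ₗ[K] V) (x y z : V) :
    d2 lb (fun a b => (c • L) a b) x y z = c • d2 lb (fun a b => L a b) x y z := by
  simp only [d2, lb, LinearMap.smul_apply, lie_smul, smul_sub, smul_add]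

lemma avg2 [IsAlgClosed K] (L : V →ₗ[K] V)
    (hL : ∀ r, H.p r = 0 → ∀ x y, ⁅r, d1 lb L x y⁆ = d1 lb L ⁅r, x⁆ y + d1 lb L x ⁅r, y⁆) :
    ∃ (L' : V →ₗ[K] V), (∀ x y, d1 lb L' x y = d1 lb L x y) ∧
      (∀ r, H.p r = 0 → ∀ x, ⁅r, L' x⁆ = L' ⁅r, x⁆) := by
  let A : Submodule K (V →ₗ[K] V) :=
    { carrier := {f | ∀ x y, d1 lb f x y = 0}
      zero_mem' := by intro x y; simp [d1]
      add_mem' := by intro f g hf hg x y; rw [d1_add, hf, hg, add_zero]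
      smul_mem' := by intro c f hf x y; rw [d1_smul, hf, smul_zero] }
  have hA : ∀ f, f ∈ A ↔ ∀ x y, d1 lb f x y = 0 := fun f => Iff.rfl
  obtain ⟨a, h, ha⟩ := H.avg (M := V →ₗ[K] V) (fun u hu => H.hss1 hu) A
    (by
      intro r hr f hf
      rw [hA] at hf ⊢
      intro x y
      rw [d1_lie, hf, hf, hf]; simp)
    L
    (by
      intro r hr
      rw [hA]
      intro x y
      rw [d1_lie, hL r hr]; abel)
  rw [hA] at h
  refine ⟨L - a, fun x y => by rw [d1_sub, h, sub_zero], fun r hr x => ?_⟩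
  have := LinearMap.congr_fun (ha r hr) x
  rw [LieHom.lie_apply, LinearMap.zero_apply, sub_eq_zero] at this
  exact this

/-- The coboundary as a bilinear map. -/
def dd1 (L : V →ₗ[K] V) : V →ₗ[K] V →ₗ[K] V :=
  LinearMap.mk₂ K (d1 lb L)
    (by intros; simp only [d1, lb, map_add, add_lie, lie_add]; abel)
    (by intros; simp only [d1, lb, map_smul, smul_lie, lie_smul, smul_sub])
    (by intros; simp only [d1, lb, map_add, add_lie, lie_add]; abel)
    (by intros; simp only [d1, lb, map_smul, smul_lie, lie_smul, smul_sub])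

lemma dd1_apply (L : V →ₗ[K] V) (x y : V) : dd1 L x y = d1 lb L x y := rfl

lemma skew_of_alt {M W : Type} [AddCommGroup M] [Module K M] [AddCommGroup W] [Module K W]
    (P : M →ₗ[K] M →ₗ[K] W) (h : ∀ x, P x x = 0) (x y : M) : P x y = - P y x := by
  have := h (x + y)
  simp only [map_add, LinearMap.add_apply, h, zero_add, add_zero] at this
  exact eq_neg_of_add_eq_zero_right this

lemma avg3 [IsAlgClosed K] (P : V →ₗ[K] V →ₗ[K] V) (hP : ∀ x, P x x = 0)
    (hc : ∀ x y z, d2 lb (fun a b => P a b) x y z = 0) :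
    ∃ (P' : V →ₗ[K] V →ₗ[K] V) (L : V →ₗ[K] V), (∀ x y, P x y = P' x y + d1 lb L x y) ∧
      (∀ r, H.p r = 0 → ∀ x y, ⁅r, P' x y⁆ = P' ⁅r, x⁆ y + P' x ⁅r, y⁆) := by
  let A : Submodule K (V →ₗ[K] V →ₗ[K] V) :=
    { carrier := {P | ∃ L : V →ₗ[K] V, ∀ x y, P x y = d1 lb L x y}
      zero_mem' := ⟨0, by simp [d1]⟩
      add_mem' := by
        rintro f g ⟨L, hL⟩ ⟨L', hL'⟩
        exact ⟨L + L', fun x y => by rw [d1_add, ← hL, ← hL']; rfl⟩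
      smul_mem' := by
        rintro c f ⟨L, hL⟩
        exact ⟨c • L, fun x y => by rw [d1_smul, ← hL]; rfl⟩ }
  obtain ⟨a, ⟨L, hL⟩, ha⟩ := H.avg (M := V →ₗ[K] V →ₗ[K] V) (fun u hu => H.hss2 hu) A
    (by
      rintro r hr f ⟨L, hL⟩
      refine ⟨⁅r, L⁆, fun x y => ?_⟩
      rw [d1_lie]
      simp only [LieHom.lie_apply, LinearMap.sub_apply, hL]
      abel)
    P
    (by
      intro r hr
      refine ⟨P r, fun x y => ?_⟩
      have h := hc r x y
      simp only [d2, d1, lb, LieHom.lie_apply, LinearMap.sub_apply] at h ⊢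
      rw [skew_of_alt P hP ⁅r, y⁆ x, skew_of_alt P hP ⁅x, y⁆ r] at h
      rw [← sub_eq_zero, ← h]; abel)
  refine ⟨P - a, L, fun x y => by simp [hL], fun r hr x y => ?_⟩
  have := LinearMap.congr_fun (LinearMap.congr_fun (ha r hr) x) y
  rw [LieHom.lie_apply, LinearMap.sub_apply, LieHom.lie_apply, LinearMap.zero_apply,
    LinearMap.zero_apply, sub_sub, sub_eq_zero] at this
  rw [this, add_comm]

lemma avg4 [IsAlgClosed K] (P : V →ₗ[K] V →ₗ[K] V) (hP : ∀ x, P x x = 0)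
    (hc : ∀ r, H.p r = 0 → ∀ x y z, ⁅r, d2 lb (fun a b => P a b) x y z⁆
      = d2 lb (fun a b => P a b) ⁅r, x⁆ y z + d2 lb (fun a b => P a b) x ⁅r, y⁆ z
        + d2 lb (fun a b => P a b) x y ⁅r, z⁆) :
    ∃ (P' : V →ₗ[K] V →ₗ[K] V), (∀ x, P' x x = 0) ∧
      (∀ x y z, d2 lb (fun a b => P' a b) x y z = d2 lb (fun a b => P a b) x y z) ∧
      (∀ r, H.p r = 0 → ∀ x y, ⁅r, P' x y⁆ = P' ⁅r, x⁆ y + P' x ⁅r, y⁆) := by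
  have halt : ∀ (r : V) (f : V →ₗ[K] V →ₗ[K] V), (∀ x, f x x = 0) →
      ∀ x, (⁅r, f⁆ : V →ₗ[K] V →ₗ[K] V) x x = 0 := by
    intro r f hf x
    rw [LieHom.lie_apply, LinearMap.sub_apply, LieHom.lie_apply, hf,
      skew_of_alt f hf x ⁅r, x⁆]; simp
  let A : Submodule K (V →ₗ[K] V →ₗ[K] V) :=
    { carrier := {P | (∀ x, P x x = 0) ∧ ∀ x y z, d2 lb (fun a b => P a b) x y z = 0}
      zero_mem' := ⟨by simp, by simp [d2]⟩
      add_mem' := by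
        rintro f g ⟨hf, hf'⟩ ⟨hg, hg'⟩
        exact ⟨fun x => by simp [hf, hg], fun x y z => by rw [d2_add, hf', hg', add_zero]⟩
      smul_mem' := by
        rintro c f ⟨hf, hf'⟩
        exact ⟨fun x => by simp [hf], fun x y z => by rw [d2_smul, hf', smul_zero]⟩ }
  obtain ⟨a, ⟨h1, h2⟩, ha⟩ := H.avg (M := V →ₗ[K] V →ₗ[K] V) (fun u hu => H.hss2 hu) A
    (by
      rintro r hr f ⟨hf, hf'⟩
      refine ⟨halt r f hf, fun x y z => ?_⟩
      rw [d2_lie, hf', hf', hf', hf']; simp)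
    P
    (by
      intro r hr
      refine ⟨halt r P hP, fun x y z => ?_⟩
      rw [d2_lie, hc r hr]; abel)
  refine ⟨P - a, fun x => by simp [hP, h1], fun x y z => by rw [d2_sub, h2, sub_zero],
    fun r hr x y => ?_⟩
  have := LinearMap.congr_fun (LinearMap.congr_fun (ha r hr) x) y
  rw [LieHom.lie_apply, LinearMap.sub_apply, LieHom.lie_apply, LinearMap.zero_apply,
    LinearMap.zero_apply, sub_sub, sub_eq_zero] at this
  rw [this, add_comm]

end
end RS
namespace RS
section
variable {K V N : Type} [Field K] [CharZero K] [LieRing V] [LieAlgebra K V]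
    [FiniteDimensional K V] [AddCommGroup N] [Module K N] (H : RS K V N)

def Inv1 (l : N →ₗ[K] N) : Prop := ∀ r, H.p r = 0 → ∀ x, H.dl r (l x) = l (H.dl r x)
def Inv2 (P : N →ₗ[K] N →ₗ[K] N) : Prop :=
  ∀ r, H.p r = 0 → ∀ x y, H.dl r (P x y) = P (H.dl r x) y + P x (H.dl r y)
def InvV (P : V →ₗ[K] V →ₗ[K] V) : Prop :=
  ∀ r, H.p r = 0 → ∀ x y, ⁅r, P x y⁆ = P ⁅r, x⁆ y + P x ⁅r, y⁆

def I1 : Prop := ∀ L : V →ₗ[K] V, (∀ x y, L ⁅x, y⁆ = ⁅L x, y⁆ + ⁅x, L y⁆) →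
  ∃ l : N →ₗ[K] N, (∀ x y, l (H.br x y) = H.br (l x) y + H.br x (l y)) ∧ H.Inv1 l ∧
    ∃ y, ∀ v, L v = H.i (l (H.p v)) + ⁅v, y⁆
def I2i : Prop := ∀ P : N →ₗ[K] N →ₗ[K] N, (∀ x, P x x = 0) → H.Inv2 P →
  (∀ x y z, d2 H.br (fun a b => P a b) x y z = 0) →
  (∃ L : V →ₗ[K] V, ∀ u v, H.i (P (H.p u) (H.p v)) = d1 lb L u v) →
  ∃ l : N →ₗ[K] N, H.Inv1 l ∧ ∀ x y, P x y = d1 H.br l x y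
def I2s : Prop := ∀ P : V →ₗ[K] V →ₗ[K] V, (∀ x, P x x = 0) →
  (∀ x y z, d2 lb (fun a b => P a b) x y z = 0) →
  ∃ Q : N →ₗ[K] N →ₗ[K] N, (∀ x, Q x x = 0) ∧ H.Inv2 Q ∧
    (∀ x y z, d2 H.br (fun a b => Q a b) x y z = 0) ∧
    ∃ L : V →ₗ[K] V, ∀ u v, P u v = H.i (Q (H.p u) (H.p v)) + d1 lb L u v
def I3 : Prop := ∀ X : N → N → N → N, IsTrilinM K X →
  (∀ x y z, (x = y ∨ y = z ∨ x = z) → X x y z = 0) →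
  (∀ r, H.p r = 0 → ∀ x y z, H.dl r (X x y z)
    = X (H.dl r x) y z + X x (H.dl r y) z + X x y (H.dl r z)) →
  (∀ x y z w, d3 H.br X x y z w = 0) →
  (∃ P : V →ₗ[K] V →ₗ[K] V, (∀ x, P x x = 0) ∧
    ∀ u v w, H.i (X (H.p u) (H.p v) (H.p w)) = d2 lb (fun a b => P a b) u v w) →
  ∃ Q : N →ₗ[K] N →ₗ[K] N, (∀ x, Q x x = 0) ∧ H.Inv2 Q ∧
    ∀ x y z, X x y z = d2 H.br (fun a b => Q a b) x y z
def H1 : Prop := ∀ f : N →ₗ[K] V, (∀ x, H.p (f x) = 0) →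
  (∀ r, H.p r = 0 → ∀ x, ⁅r, f x⁆ = f (H.dl r x)) → (∀ x y, f (H.br x y) = 0) →
  ∀ x, f x = 0
def H2 : Prop := ∀ F : N →ₗ[K] N →ₗ[K] V, (∀ x, F x x = 0) → (∀ x y, H.p (F x y) = 0) →
  (∀ r, H.p r = 0 → ∀ x y, ⁅r, F x y⁆ = F (H.dl r x) y + F x (H.dl r y)) →
  (∀ x y z, F (H.br x y) z - F (H.br x z) y + F (H.br y z) x = 0) →
  ∃ f : N →ₗ[K] V, (∀ x, H.p (f x) = 0) ∧
    (∀ r, H.p r = 0 → ∀ x, ⁅r, f x⁆ = f (H.dl r x)) ∧ ∀ x y, F x y = - f (H.br x y)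
def CC : Prop := (∀ u ∈ H.U, u = 0) ∨ ((∃ u ∈ H.U, u ≠ 0) ∧
  (∀ x : V, (∀ y : V, ⁅x, y⁆ = 0) → x = 0) ∧
  (∀ L : V →ₗ[K] V, (∀ x y, L ⁅x, y⁆ = ⁅L x, y⁆ + ⁅x, L y⁆) → ∃ y : V, ∀ x, L x = ⁅y, x⁆))

lemma D_of_U0 (h : ∀ u ∈ H.U, u = 0) {r : V} (hr : H.p r = 0) : r ∈ H.D := by
  obtain ⟨u, hu, s, hs, rfl⟩ := H.hUD r hr
  rw [h u hu, zero_add]; exact hs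

lemma D_ind (h : ∀ u ∈ H.U, u = 0) {C : V → Prop}
    (hb : ∀ a b, H.p a = 0 → H.p b = 0 → C ⁅a, b⁆) (h0 : C 0)
    (hadd : ∀ x y, C x → C y → C (x + y)) (hsm : ∀ (c : K) x, C x → C (c • x))
    {r : V} (hr : H.p r = 0) : C r := by
  have h1 : ∀ x ∈ Submodule.span K {z | ∃ u v : V, H.p u = 0 ∧ H.p v = 0 ∧ z = ⁅u, v⁆},
      C x := by
    intro x hx
    induction hx using Submodule.span_induction with
    | mem x h => obtain ⟨u, v, hu, hv, rfl⟩ := h; exact hb u v hu hv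
    | zero => exact h0
    | add x y _ _ hx hy => exact hadd _ _ hx hy
    | smul a x _ hx => exact hsm _ _ hx
  exact h1 r (H.hD ▸ H.D_of_U0 h hr)

lemma left1 [IsAlgClosed K] (h1 : H.H1) (hc : H.CC) : H.I1 := by
  intro L0 hL0
  obtain ⟨y, L, hy, hL, hinv⟩ := H.avg1 L0 hL0
  have hz : ∀ r, H.p r = 0 → ∀ x : V, ⁅L r, x⁆ = 0 := by
    intro r hr x
    have := hL r x
    rw [hinv r hr x] at this
    simpa using this
  have hLR : ∀ r, H.p r = 0 → L r = 0 := by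
    intro r hr
    rcases hc with hc | ⟨_, hc, _⟩
    · refine H.D_ind hc (C := fun r => L r = 0) ?_ (by simp) (fun x y hx hy => by simp [hx, hy])
        (fun c x hx => by simp [hx]) hr
      intro a b ha hb
      rw [hL, hz a ha, ← lie_skew, hz b hb]; simp
    · exact hc _ (hz r hr)
  have hf := h1 (H.q ∘ₗ L ∘ₗ H.i) (fun x => H.p_q _)
    (fun r hr x => by
      simp only [LinearMap.comp_apply]
      rw [← H.q_lie_R hr, hinv r hr, i_dl])
    (fun x y => by
      simp only [LinearMap.comp_apply]
      rw [i_br, hL, map_add, q_lie_i, q_i_lie, add_zero])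
  have hLi : ∀ x, L (H.i x) = H.i (H.p (L (H.i x))) := by
    intro x
    have := hf x
    simpa [q_apply, sub_eq_zero] using this
  refine ⟨H.p ∘ₗ L ∘ₗ H.i, fun x z => ?_, fun r hr x => ?_, -y, fun v => ?_⟩
  · apply H.i_inj
    simp only [LinearMap.comp_apply, map_add, i_br]
    rw [← hLi, ← hLi, ← i_br, ← hLi, i_br, hL]
  · simp only [LinearMap.comp_apply]
    rw [← H.p_lie_R hr, hinv r hr, i_dl]
  · simp only [LinearMap.comp_apply]
    rw [← hLi, hy, lie_neg, lie_skew]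
    congr 1
    conv_lhs => rw [H.dec v]
    rw [map_add, hLR _ (H.p_q v), zero_add]

/-- Extension by zero. -/
def ext2 (P : N →ₗ[K] N →ₗ[K] N) : V →ₗ[K] V →ₗ[K] V := (P.compl₁₂ H.p H.p).compr₂ H.i
lemma ext2_apply (P : N →ₗ[K] N →ₗ[K] N) (u v : V) :
    H.ext2 P u v = H.i (P (H.p u) (H.p v)) := rfl

lemma ext2_inv {P : N →ₗ[K] N →ₗ[K] N} (hP : H.Inv2 P) : H.InvV (H.ext2 P) := by
  intro r hr x y
  simp only [ext2_apply]
  rw [← i_dl, hP r hr, map_add, H.p_lie_R hr, H.p_lie_R hr]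

lemma d2_ext2 (P : N →ₗ[K] N →ₗ[K] N) (x y z : N) :
    d2 lb (fun a b => H.ext2 P a b) (H.i x) (H.i y) (H.i z)
      = H.i (d2 H.br (fun a b => P a b) x y z) := by
  simp only [d2, lb, ext2_apply, H.pi, map_add, map_sub, i_br]; rfl

lemma d2_d1 (L : V →ₗ[K] V) (x y z : V) : d2 lb (d1 lb L) x y z = 0 := by
  have J : L ⁅x, ⁅y, z⁆⁆ = L ⁅y, ⁅x, z⁆⁆ - L ⁅z, ⁅x, y⁆⁆ := by
    rw [leibniz_lie x, map_add, ← lie_skew z, map_neg]; abel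
  simp only [d2, d1, lb, lie_sub, lie_lie, map_sub]
  simp only [← lie_skew y x, ← lie_skew z x, ← lie_skew z y, lie_neg, map_neg, J]
  abel

lemma d1_inv {L : V →ₗ[K] V} (hL : ∀ r, H.p r = 0 → ∀ x, ⁅r, L x⁆ = L ⁅r, x⁆) :
    H.InvV (dd1 L) := by
  intro r hr x y
  have h0 : (⁅r, L⁆ : V →ₗ[K] V) = 0 := by
    ext x; rw [LieHom.lie_apply, hL r hr, sub_self]; rfl
  have := d1_lie L r x y
  rw [h0] at this
  simp only [dd1_apply]
  rw [← sub_eq_zero, ← sub_sub, ← this]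
  simp [d1]

lemma dd1_alt (L : V →ₗ[K] V) (x : V) : dd1 L x x = 0 := by
  simp [dd1_apply, d1]

lemma d1_R {L : V →ₗ[K] V} (hL : ∀ r, H.p r = 0 → ∀ x, ⁅r, L x⁆ = L ⁅r, x⁆) {r : V}
    (hr : H.p r = 0) (x : V) : d1 lb L r x = ⁅L r, x⁆ := by
  simp only [d1, lb]
  rw [hL r hr, ← lie_skew (L r)]; abel

lemma factor2 (P : V →ₗ[K] V →ₗ[K] V) (ha : ∀ x, P x x = 0)
    (hR : ∀ r, H.p r = 0 → ∀ x, P r x = 0) (u v : V) :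
    P u v = P (H.i (H.p u)) (H.i (H.p v)) := by
  conv_lhs => rw [H.dec u, H.dec v]
  rw [map_add P, LinearMap.add_apply, hR _ (H.p_q u), zero_add, map_add,
    skew_of_alt P ha _ (H.q v), hR _ (H.p_q v), neg_zero, zero_add]

lemma factor2' (P : V →ₗ[K] V →ₗ[K] V) (ha : ∀ x, P x x = 0) (hinv : H.InvV P)
    (hR : ∀ r, H.p r = 0 → ∀ x, P r x = 0) (hq : ∀ x y, H.q (P (H.i x) (H.i y)) = 0) :
    ∃ Q : N →ₗ[K] N →ₗ[K] N, (∀ x, Q x x = 0) ∧ H.Inv2 Q ∧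
      ∀ u v, P u v = H.i (Q (H.p u) (H.p v)) := by
  refine ⟨(P.compl₁₂ H.i H.i).compr₂ H.p, fun x => by simp [ha], fun r hr x y => ?_,
    fun u v => ?_⟩
  · simp only [LinearMap.compr₂_apply, LinearMap.compl₁₂_apply]
    rw [← H.p_lie_R hr, hinv r hr, map_add, i_dl, i_dl]
  · rw [H.factor2 P ha hR]
    have := hq (H.p u) (H.p v)
    rw [q_apply, sub_eq_zero] at this
    exact this

lemma d2_R (P : V →ₗ[K] V →ₗ[K] V) (ha : ∀ x, P x x = 0) (hinv : H.InvV P)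
    {r : V} (hr : H.p r = 0) (x y : V) :
    d2 lb (fun a b => P a b) r x y = P r ⁅x, y⁆ - ⁅x, P r y⁆ - ⁅P r x, y⁆ := by
  simp only [d2, lb]
  rw [hinv r hr, skew_of_alt P ha ⁅r, y⁆ x, skew_of_alt P ha ⁅x, y⁆ r, ← lie_skew (P r x) y]
  abel

lemma lemP [IsAlgClosed K] (h2 : H.H2) (hc : H.CC) (P : V →ₗ[K] V →ₗ[K] V)
    (ha : ∀ x, P x x = 0) (hinv : H.InvV P)
    (hdR : ∀ r, H.p r = 0 → ∀ x y, d2 lb (fun a b => P a b) r x y = 0)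
    (hdN : ∀ x y z, H.q (d2 lb (fun a b => P a b) (H.i x) (H.i y) (H.i z)) = 0) :
    ∃ Q : N →ₗ[K] N →ₗ[K] N, (∀ x, Q x x = 0) ∧ H.Inv2 Q ∧ ∃ L : V →ₗ[K] V,
      ∀ u v, P u v = H.i (Q (H.p u) (H.p v)) + d1 lb L u v := by
  have hder : ∀ r, H.p r = 0 → ∀ x y, P r ⁅x, y⁆ = ⁅P r x, y⁆ + ⁅x, P r y⁆ := by
    intro r hr x y
    have := hdR r hr x y
    rw [H.d2_R P ha hinv hr, sub_sub, sub_eq_zero] at this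
    rw [this, add_comm]
  have hinn : ∀ r, H.p r = 0 → ∃ t : V, ∀ x, P r x = ⁅t, x⁆ := by
    intro r hr
    rcases hc with hc | ⟨_, _, hc⟩
    · refine H.D_ind hc (C := fun r => ∃ t : V, ∀ x, P r x = ⁅t, x⁆) ?_ ⟨0, by simp⟩ ?_ ?_ hr
      · intro a b ha hb
        refine ⟨- P b a, fun x => ?_⟩
        have := hinv a ha b x
        rw [hder b hb] at this
        rw [neg_lie, eq_neg_iff_add_eq_zero]
        have h3 : P ⁅a, b⁆ x + ⁅P b a, x⁆ + ⁅a, P b x⁆ = 0 + ⁅a, P b x⁆ := by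
          rw [add_assoc, ← this, zero_add]
        exact add_right_cancel h3
      · rintro x y ⟨t, ht⟩ ⟨t', ht'⟩
        exact ⟨t + t', fun z => by simp [ht, ht']⟩
      · rintro c x ⟨t, ht⟩
        exact ⟨c • t, fun z => by simp [ht]⟩
    · exact hc (P r) (hder r hr)
  -- complement of the centre
  let Z : Submodule K V :=
    { carrier := {z | ∀ x : V, ⁅z, x⁆ = 0}
      zero_mem' := fun x => zero_lie x
      add_mem' := fun {a b} ha hb x => by rw [add_lie, ha, hb, add_zero]
      smul_mem' := fun c a ha x => by rw [smul_lie, ha, smul_zero] }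
  have hZ : ∀ z, z ∈ Z ↔ ∀ x : V, ⁅z, x⁆ = 0 := fun z => Iff.rfl
  obtain ⟨W, hW, hst⟩ := H.hss Z (by
    intro r hr x hx
    rw [hZ] at hx
    have : ⁅r, x⁆ = 0 := by rw [← lie_skew, hx, neg_zero]
    rw [this]; exact Z.zero_mem)
  have huniq : ∀ a ∈ W, ∀ b ∈ W, (∀ x : V, ⁅a, x⁆ = ⁅b, x⁆) → a = b := by
    intro a ha b hb h
    rw [← sub_eq_zero]
    exact Submodule.disjoint_def.1 hW.disjoint _
      ((hZ _).2 fun x => by rw [sub_lie, h, sub_self]) (sub_mem ha hb)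
  have hex : ∀ v, ∃ t ∈ W, ∀ x, P (H.q v) x = ⁅t, x⁆ := by
    intro v
    obtain ⟨t, ht⟩ := hinn _ (H.p_q v)
    obtain ⟨a, ha, b, hb, rfl⟩ :=
      Submodule.mem_sup.1 (hW.sup_eq_top ▸ Submodule.mem_top : t ∈ _)
    refine ⟨b, hb, fun x => ?_⟩
    rw [ht, add_lie, (hZ a).1 ha, zero_add]
  choose τ0 hτW hτ using hex
  let τ : V →ₗ[K] V :=
    { toFun := τ0
      map_add' := fun x y => huniq _ (hτW _) _ (add_mem (hτW _) (hτW _)) fun z => by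
        rw [← hτ, add_lie, ← hτ, ← hτ]; simp
      map_smul' := fun c x => huniq _ (hτW _) _ (W.smul_mem _ (hτW _)) fun z => by
        rw [← hτ, RingHom.id_apply, smul_lie, ← hτ]; simp }
  have hτ' : ∀ r, H.p r = 0 → ∀ x, P r x = ⁅τ r, x⁆ := by
    intro r hr x
    have := hτ r x
    rwa [H.q_R hr] at this
  have hτi : ∀ r, H.p r = 0 → ∀ x, ⁅r, τ x⁆ = τ ⁅r, x⁆ := by
    intro r hr v
    refine huniq _ (hst r hr _ (hτW _)) _ (hτW _) fun x => ?_
    change ⁅⁅r, τ0 v⁆, x⁆ = ⁅τ0 ⁅r, v⁆, x⁆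
    rw [← hτ, H.q_lie_R hr, lie_lie, ← hτ, ← hτ, hinv r hr]; abel
  let P' := P - dd1 τ
  have ha' : ∀ x, P' x x = 0 := fun x => by simp [P', ha, dd1_alt]
  have hinv' : H.InvV P' := by
    intro r hr x y
    have e1 := hinv r hr x y
    have e2 := H.d1_inv hτi r hr x y
    simp only [P', LinearMap.sub_apply, lie_sub, e1, e2]
    abel
  have hR' : ∀ r, H.p r = 0 → ∀ x, P' r x = 0 := by
    intro r hr x
    simp only [P', LinearMap.sub_apply, dd1_apply]
    rw [H.d1_R hτi hr, hτ' r hr, sub_self]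
  have hd' : ∀ x y z, d2 lb (fun a b => P' a b) x y z = d2 lb (fun a b => P a b) x y z := by
    intro x y z
    rw [d2_sub]
    have := d2_d1 τ x y z
    change _ - d2 lb (d1 lb τ) x y z = _
    rw [this, sub_zero]
  obtain ⟨f, hf0, hfi, hF⟩ := h2 ((P'.compl₁₂ H.i H.i).compr₂ H.q) (fun x => by simp [ha'])
    (fun x y => by simp [p_q])
    (fun r hr x y => by
      simp only [LinearMap.compr₂_apply, LinearMap.compl₁₂_apply]
      rw [← H.q_lie_R hr, hinv' r hr, map_add, i_dl, i_dl])
    (fun x y z => by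
      have := hdN x y z
      rw [← hd'] at this
      simp only [d2, lb, map_sub, map_add, q_i_lie] at this
      simp only [LinearMap.compr₂_apply, LinearMap.compl₁₂_apply, i_br]
      rw [← neg_eq_zero, ← this]; abel)
  have hfp : ∀ r, H.p r = 0 → ∀ x, ⁅r, (f ∘ₗ H.p) x⁆ = (f ∘ₗ H.p) ⁅r, x⁆ := by
    intro r hr x
    simp only [LinearMap.comp_apply]
    rw [H.p_lie_R hr, hfi r hr]
  obtain ⟨Q, hQ0, hQi, hQ⟩ := H.factor2' (P' - dd1 (f ∘ₗ H.p))
    (fun x => by simp [ha', dd1_alt])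
    (by
      intro r hr x y
      have e1 := hinv' r hr x y
      have e2 := H.d1_inv hfp r hr x y
      simp only [LinearMap.sub_apply, lie_sub, e1, e2]
      abel)
    (by
      intro r hr x
      rw [LinearMap.sub_apply, LinearMap.sub_apply, dd1_apply, H.d1_R hfp hr, hR' r hr]
      simp [hr])
    (by
      intro x y
      have := hF x y
      simp only [LinearMap.compr₂_apply, LinearMap.compl₁₂_apply] at this
      rw [LinearMap.sub_apply, LinearMap.sub_apply, map_sub, this]
      simp only [dd1_apply, d1, lb, map_sub, q_i_lie, LinearMap.comp_apply]
      rw [H.q_R (hf0 _)]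
      simp [br])
  refine ⟨Q, hQ0, hQi, τ + f ∘ₗ H.p, fun u v => ?_⟩
  rw [← hQ, d1_add]
  simp only [P', LinearMap.sub_apply, dd1_apply]
  abel

lemma left2i [IsAlgClosed K] (h1 : H.H1) : H.I2i := by
  rintro P ha hinv - ⟨L0, hL0⟩
  obtain ⟨L, hL, hLi⟩ := H.avg2 L0 (by
    intro r hr x y
    simp only [← hL0]
    exact H.ext2_inv hinv r hr x y)
  have hP : ∀ u v, H.i (P (H.p u) (H.p v)) = d1 lb L u v := fun u v => by rw [hL0, hL]
  have hf := h1 (H.q ∘ₗ L ∘ₗ H.i) (fun x => H.p_q _)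
    (fun r hr x => by
      simp only [LinearMap.comp_apply]
      rw [← H.q_lie_R hr, hLi r hr, i_dl])
    (fun x y => by
      have := congrArg H.q (hP (H.i x) (H.i y))
      simp only [d1, lb, q_i, map_sub, q_i_lie] at this
      simp only [LinearMap.comp_apply, i_br]
      simpa using this.symm)
  have hLi' : ∀ x, L (H.i x) = H.i (H.p (L (H.i x))) := by
    intro x
    have := hf x
    simpa [q_apply, sub_eq_zero] using this
  refine ⟨H.p ∘ₗ L ∘ₗ H.i, fun r hr x => ?_, fun x y => ?_⟩
  · simp only [LinearMap.comp_apply]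
    rw [← H.p_lie_R hr, hLi r hr, i_dl]
  · apply H.i_inj
    have := hP (H.i x) (H.i y)
    rw [H.pi, H.pi] at this
    rw [this]
    simp only [d1, lb, LinearMap.comp_apply, map_sub, i_br]
    rw [← hLi', ← hLi', ← i_br, ← hLi']

lemma left2s [IsAlgClosed K] (h2 : H.H2) (hc : H.CC) : H.I2s := by
  intro P0 ha0 hcoc0
  obtain ⟨P, L, hP, hinv⟩ := H.avg3 P0 ha0 hcoc0
  have hPe : P = P0 - dd1 L := by
    ext x y; simp [hP, dd1_apply]
  have ha : ∀ x, P x x = 0 := fun x => by simp [hPe, ha0, dd1_alt]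
  have hcoc : ∀ x y z, d2 lb (fun a b => P a b) x y z = 0 := by
    intro x y z
    rw [hPe, d2_sub, hcoc0]
    have := d2_d1 L x y z
    change _ - d2 lb (d1 lb L) x y z = _
    rw [this, sub_zero]
  obtain ⟨Q, hQ, hQi, L', h⟩ := H.lemP h2 hc P ha hinv (fun r hr x y => hcoc _ _ _)
    (fun x y z => by rw [hcoc, map_zero])
  refine ⟨Q, hQ, hQi, fun x y z => ?_, L' + L, fun u v => by rw [hP, h, d1_add, add_assoc]⟩
  apply H.i_inj
  rw [← d2_ext2, map_zero]
  have e : H.ext2 Q = P - dd1 L' := by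
    ext u v; simp [h, ext2_apply, dd1_apply]
  rw [e, d2_sub, hcoc]
  have := d2_d1 L' (H.i x) (H.i y) (H.i z)
  change _ - d2 lb (d1 lb L') _ _ _ = _
  rw [this, sub_zero]

lemma left3 [IsAlgClosed K] (h2 : H.H2) (hc : H.CC) : H.I3 := by
  rintro X hX - hXi - ⟨P0, ha0, hP0⟩
  have hX0 : ∀ y z, X 0 y z = 0 := by
    intro y z
    have := hX.1 1 0 0 y z
    simpa using this
  obtain ⟨P, ha, hd, hinv⟩ := H.avg4 P0 ha0 (by
    intro r hr x y z
    simp only [← hP0]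
    rw [← i_dl, hXi r hr, map_add, map_add, H.p_lie_R hr, H.p_lie_R hr, H.p_lie_R hr])
  obtain ⟨Q, hQ, hQi, L', h⟩ := H.lemP h2 hc P ha hinv
    (fun r hr x y => by rw [hd, ← hP0, hr, hX0, map_zero])
    (fun x y z => by rw [hd, ← hP0, q_i])
  refine ⟨Q, hQ, hQi, fun x y z => ?_⟩
  apply H.i_inj
  rw [← d2_ext2]
  have e : H.ext2 Q = P - dd1 L' := by
    ext u v; simp [h, ext2_apply, dd1_apply]
  rw [e, d2_sub, hd, ← hP0, H.pi, H.pi, H.pi]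
  have := d2_d1 L' (H.i x) (H.i y) (H.i z)
  change _ = _ - d2 lb (d1 lb L') _ _ _
  rw [this, sub_zero]

end
end RS
namespace RS
section
variable {K V N : Type} [Field K] [CharZero K] [LieRing V] [LieAlgebra K V]
    [FiniteDimensional K V] [AddCommGroup N] [Module K N] (H : RS K V N)

lemma ilp_inv {l : N →ₗ[K] N} (hl : H.Inv1 l) :
    ∀ r, H.p r = 0 → ∀ x, ⁅r, (H.i ∘ₗ l ∘ₗ H.p) x⁆ = (H.i ∘ₗ l ∘ₗ H.p) ⁅r, x⁆ := by
  intro r hr x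
  simp only [LinearMap.comp_apply]
  rw [← i_dl, hl r hr, H.p_lie_R hr]

lemma d1_ilp {l : N →ₗ[K] N} (hl : H.Inv1 l) (u v : V) :
    d1 lb (H.i ∘ₗ l ∘ₗ H.p) u v = H.i (d1 H.br l (H.p u) (H.p v)) := by
  have h := H.factor2 (dd1 (H.i ∘ₗ l ∘ₗ H.p)) (dd1_alt _)
    (fun r hr x => by rw [dd1_apply, H.d1_R (H.ilp_inv hl) hr]; simp [hr]) u v
  rw [dd1_apply, dd1_apply] at h
  rw [h]
  simp only [d1, lb, LinearMap.comp_apply, H.pi, map_sub, i_br]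
  rfl

lemma right1 [IsAlgClosed K] (i1 : H.I1) (i2 : H.I2i) : H.H1 := by
  intro f hf0 hfi hfb
  have hfp : ∀ r, H.p r = 0 → ∀ x, ⁅r, (f ∘ₗ H.p) x⁆ = (f ∘ₗ H.p) ⁅r, x⁆ := by
    intro r hr x
    simp only [LinearMap.comp_apply]
    rw [H.p_lie_R hr, hfi r hr]
  obtain ⟨Q, hQ0, hQi, hQ⟩ := H.factor2' (dd1 (f ∘ₗ H.p)) (dd1_alt _) (H.d1_inv hfp)
    (fun r hr x => by rw [dd1_apply, H.d1_R hfp hr]; simp [hr])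
    (fun x y => by
      simp only [dd1_apply, d1, lb, LinearMap.comp_apply, map_sub, q_i_lie]
      have := hfb x y
      rw [br] at this
      rw [this]; simp)
  obtain ⟨l, hl, hlQ⟩ := i2 Q hQ0 hQi
    (fun x y z => by
      apply H.i_inj
      rw [← d2_ext2, map_zero, ← d2_d1 (f ∘ₗ H.p) (H.i x) (H.i y) (H.i z)]
      congr 1
      funext a b
      rw [ext2_apply, ← hQ, dd1_apply])
    ⟨f ∘ₗ H.p, fun u v => by rw [← hQ, dd1_apply]⟩
  obtain ⟨l', _, _, y, hy⟩ := i1 (f ∘ₗ H.p - H.i ∘ₗ l ∘ₗ H.p) (by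
    intro x y
    have : d1 lb (f ∘ₗ H.p - H.i ∘ₗ l ∘ₗ H.p : V →ₗ[K] V) x y = 0 := by
      rw [d1_sub, H.d1_ilp hl, ← hlQ, ← hQ, dd1_apply, sub_self]
    rw [d1, sub_eq_zero] at this
    simp only [lb] at this
    rw [← this, ← lie_skew _ y]; abel)
  intro x
  have := congrArg H.q (hy (H.i x))
  simp only [LinearMap.sub_apply, LinearMap.comp_apply, H.pi, map_sub, map_add, q_i, q_i_lie,
    H.q_R (hf0 _)] at this
  simpa using this

lemma d2_swap (P : V →ₗ[K] V →ₗ[K] V) (ha : ∀ x, P x x = 0) (x y z : V) :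
    d2 lb (fun a b => P a b) x y z = - d2 lb (fun a b => P a b) y x z := by
  simp only [d2, lb]
  rw [skew_of_alt P ha x y, ← lie_skew x y]
  simp only [map_neg, LinearMap.neg_apply, lie_neg]
  abel

lemma d2_cyc (P : V →ₗ[K] V →ₗ[K] V) (ha : ∀ x, P x x = 0) (x y z : V) :
    d2 lb (fun a b => P a b) x y z = d2 lb (fun a b => P a b) y z x := by
  simp only [d2, lb]
  rw [skew_of_alt P ha z x, skew_of_alt P ha y x, ← lie_skew z x, ← lie_skew y x]
  simp only [map_neg, LinearMap.neg_apply, lie_neg]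
  abel

lemma d2_add1 (P : V →ₗ[K] V →ₗ[K] V) (x x' y z : V) :
    d2 lb (fun a b => P a b) (x + x') y z
      = d2 lb (fun a b => P a b) x y z + d2 lb (fun a b => P a b) x' y z := by
  simp only [d2, lb, map_add, LinearMap.add_apply, lie_add, add_lie]
  abel

lemma d2_smul1 (P : V →ₗ[K] V →ₗ[K] V) (c : K) (x y z : V) :
    d2 lb (fun a b => P a b) (c • x) y z = c • d2 lb (fun a b => P a b) x y z := by
  simp only [d2, lb, map_smul, LinearMap.smul_apply, lie_smul, smul_lie, smul_add, smul_sub]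

lemma d2_factor (P : V →ₗ[K] V →ₗ[K] V) (ha : ∀ x, P x x = 0)
    (h : ∀ r, H.p r = 0 → ∀ x y, d2 lb (fun a b => P a b) r x y = 0) (u v w : V) :
    d2 lb (fun a b => P a b) u v w
      = d2 lb (fun a b => P a b) (H.i (H.p u)) (H.i (H.p v)) (H.i (H.p w)) := by
  have key : ∀ u v w, d2 lb (fun a b => P a b) u v w
      = d2 lb (fun a b => P a b) (H.i (H.p u)) v w := by
    intro u v w
    conv_lhs => rw [H.dec u]
    rw [d2_add1, h _ (H.p_q u), zero_add]
  rw [key u, d2_cyc P ha, key v, d2_cyc P ha, key w, d2_cyc P ha]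

lemma d3_d2 (P : V →ₗ[K] V →ₗ[K] V) (ha : ∀ x, P x x = 0) (x y z w : V) :
    d3 lb (d2 lb (fun a b => P a b)) x y z w = 0 := by
  have J : ∀ x y z t : V, P ⁅x, ⁅y, z⁆⁆ t = P ⁅y, ⁅x, z⁆⁆ t - P ⁅z, ⁅x, y⁆⁆ t := by
    intro x y z t
    rw [leibniz_lie x, map_add, ← lie_skew z, map_neg]
    simp only [LinearMap.add_apply, LinearMap.neg_apply]; abel
  simp only [d3, d2, lb, lie_sub, lie_add, lie_lie, map_sub, LinearMap.sub_apply]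
  rw [skew_of_alt P ha ⁅z, w⁆ ⁅x, y⁆, skew_of_alt P ha ⁅y, w⁆ ⁅x, z⁆,
    skew_of_alt P ha ⁅y, z⁆ ⁅x, w⁆]
  simp only [← lie_skew y x, ← lie_skew z x, ← lie_skew z y, ← lie_skew w x, ← lie_skew w y,
    ← lie_skew w z, lie_neg, map_neg, LinearMap.neg_apply]
  rw [J x y z, J x y w, J x z w, J y z w]
  abel

lemma right2 [IsAlgClosed K] (i2 : H.I2s) (i3 : H.I3) : H.H2 := by
  intro F hF0 hFp hFi hFc
  let P : V →ₗ[K] V →ₗ[K] V := F.compl₁₂ H.p H.p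
  have hPa : ∀ u v, P u v = F (H.p u) (H.p v) := fun u v => rfl
  have ha : ∀ x, P x x = 0 := fun x => hF0 _
  have hinv : H.InvV P := by
    intro r hr x y
    simp only [hPa]
    rw [hFi r hr, H.p_lie_R hr, H.p_lie_R hr]
  have hPR : ∀ r, H.p r = 0 → ∀ x, P r x = 0 := fun r hr x => by simp [hPa, hr]
  have hdR : ∀ Q : V →ₗ[K] V →ₗ[K] V, (∀ x, Q x x = 0) → H.InvV Q →
      (∀ r, H.p r = 0 → ∀ x, Q r x = 0) →
      ∀ r, H.p r = 0 → ∀ x y, d2 lb (fun a b => Q a b) r x y = 0 := by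
    intro Q ha hinv hQR r hr x y
    rw [H.d2_R Q ha hinv hr, hQR r hr, hQR r hr, hQR r hr]; simp
  have hdinv : ∀ r, H.p r = 0 → ∀ x y z, ⁅r, d2 lb (fun a b => P a b) x y z⁆
      = d2 lb (fun a b => P a b) ⁅r, x⁆ y z + d2 lb (fun a b => P a b) x ⁅r, y⁆ z
        + d2 lb (fun a b => P a b) x y ⁅r, z⁆ := by
    intro r hr x y z
    have h0 : (⁅r, P⁆ : V →ₗ[K] V →ₗ[K] V) = 0 := by
      ext x y
      rw [LieHom.lie_apply, LinearMap.sub_apply, LieHom.lie_apply, hinv r hr]; simp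
    have := d2_lie P r x y z
    rw [h0] at this
    rw [← sub_eq_zero, ← sub_sub, ← sub_sub, ← this]
    simp [d2]
  let X : N → N → N → N := fun x y z =>
    H.p (d2 lb (fun a b => P a b) (H.i x) (H.i y) (H.i z))
  have hiX : ∀ x y z, H.i (X x y z) = d2 lb (fun a b => P a b) (H.i x) (H.i y) (H.i z) := by
    intro x y z
    have h : H.q (d2 lb (fun a b => P a b) (H.i x) (H.i y) (H.i z)) = 0 := by
      have := hFc x y z
      simp only [d2, lb, map_sub, map_add, q_i_lie, hPa, H.pi, H.q_R (hFp _ _)]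
      simp only [br] at this
      rw [← neg_eq_zero]
      refine Eq.trans ?_ this
      abel
    rw [q_apply, sub_eq_zero] at h
    exact h.symm
  have hlin1 : ∀ (a : K) x x' y z, X (a • x + x') y z = a • X x y z + X x' y z := by
    intro a x x' y z
    simp only [X, map_add, map_smul]
    rw [d2_add1, d2_smul1, map_add, map_smul]
  have hcyc : ∀ x y z, X x y z = X y z x := by
    intro x y z
    simp only [X]; rw [d2_cyc P ha]
  obtain ⟨Q, hQ0, hQi, hQ⟩ := i3 X
    ⟨hlin1, fun a x y y' z => by rw [hcyc, hlin1, ← hcyc x y, ← hcyc x y'],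
      fun a x y z z' => by rw [← hcyc, hlin1, hcyc, hcyc z']⟩
    (by
      have h1 : ∀ x z, X x x z = 0 := by
        intro x z
        simp only [X, d2, lb, ha, lie_self, map_zero, LinearMap.zero_apply, lie_zero]
        simp
      rintro x y z (rfl | rfl | rfl)
      · exact h1 _ _
      · rw [hcyc, h1]
      · rw [← hcyc, h1])
    (by
      intro r hr x y z
      apply H.i_inj
      rw [map_add, map_add, i_dl, hiX, hdinv r hr, hiX, hiX, hiX, i_dl, i_dl, i_dl])
    (by
      intro x y z w
      apply H.i_inj
      rw [map_zero, ← d3_d2 P ha (H.i x) (H.i y) (H.i z) (H.i w)]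
      simp only [d3, map_add, map_sub, i_br, hiX, lb])
    ⟨P, ha, fun u v w => by rw [hiX, ← H.d2_factor P ha (hdR P ha hinv hPR)]⟩
  have hEa : ∀ x, (H.ext2 Q) x x = 0 := fun x => by rw [ext2_apply, hQ0, map_zero]
  have ha' : ∀ x, (P - H.ext2 Q) x x = 0 := fun x => by simp [ha, hEa]
  have hinv' : H.InvV (P - H.ext2 Q) := by
    intro r hr x y
    have e1 := hinv r hr x y
    have e2 := H.ext2_inv hQi r hr x y
    simp only [LinearMap.sub_apply, lie_sub, e1, e2]
    abel
  obtain ⟨Q', hQ0', hQi', _, L0, hL0⟩ := i2 (P - H.ext2 Q) ha' (by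
    intro u v w
    rw [H.d2_factor _ ha' (hdR _ ha' hinv'
      (fun r hr x => by simp [hPR r hr, ext2_apply, hr])), d2_sub, d2_ext2, ← hQ, hiX, sub_self])
  have hd0 : dd1 L0 = P - H.ext2 Q - H.ext2 Q' := by
    ext u v
    rw [LinearMap.sub_apply, LinearMap.sub_apply, hL0, ext2_apply, dd1_apply]; abel
  obtain ⟨L, hL, hLi⟩ := H.avg2 L0 (by
    intro r hr x y
    simp only [← dd1_apply, hd0]
    have e1 := hinv' r hr x y
    have e2 := H.ext2_inv hQi' r hr x y
    rw [LinearMap.sub_apply, LinearMap.sub_apply, lie_sub, e1, e2]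
    simp only [LinearMap.sub_apply]
    abel)
  refine ⟨H.q ∘ₗ L ∘ₗ H.i, fun x => H.p_q _, fun r hr x => ?_, fun x y => ?_⟩
  · simp only [LinearMap.comp_apply]
    rw [← H.q_lie_R hr, hLi r hr, i_dl]
  · have h := congrArg H.q (hL0 (H.i x) (H.i y))
    rw [← hL] at h
    simp only [LinearMap.sub_apply, ext2_apply, map_sub, map_add, q_i, d1, lb, q_i_lie, hPa,
      H.pi, H.q_R (hFp _ _)] at h
    simp only [LinearMap.comp_apply, i_br]
    rw [sub_zero] at h
    rw [h]; simp

lemma rightC [IsAlgClosed K] (i1 : H.I1) (i2 : H.I2s) : H.CC := by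
  by_cases hU : ∀ u ∈ H.U, u = 0
  · exact Or.inl hU
  push Not at hU
  obtain ⟨u, hu, hu0⟩ := hU
  have hup := ((H.hU u).1 hu).1
  obtain ⟨lam, hlam, hlD⟩ : ∃ lam : V →ₗ[K] K, lam u = 1 ∧ ∀ x ∈ H.D, lam x = 0 := by
    have hn : u ∉ H.D := fun h => hu0 (H.hUD0 u hu h)
    obtain ⟨g, hg, hg'⟩ := Submodule.exists_le_ker_of_notMem hn
    refine ⟨(g u)⁻¹ • g, by simp [hg], fun x hx => ?_⟩
    have : g x = 0 := hg' hx
    simp [this]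
  let mu : V →ₗ[K] K := lam ∘ₗ H.q
  have hmuu : mu u = 1 := by simp [mu, H.q_R hup, hlam]
  have hmub : ∀ x y : V, mu ⁅x, y⁆ = 0 := by
    intro x y
    simp only [mu, LinearMap.comp_apply]
    rw [q_lie]
    exact hlD _ (H.lie_D (H.p_q x) (H.p_q y))
  refine Or.inr ⟨⟨u, hu, hu0⟩, ?_, ?_⟩
  · intro z hz
    have hz' : ∀ y : V, ⁅y, z⁆ = 0 := fun y => by rw [← lie_skew, hz, neg_zero]
    obtain ⟨l, _, _, y, hy⟩ := i1 (mu.smulRight z) (by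
      intro x y
      simp [hmub, hz, hz'])
    have h := hy u
    simp only [LinearMap.smulRight_apply, hmuu, one_smul, hup, map_zero, zero_add] at h
    have h2 := H.ss_ker hu 0 y (by
      simp only [zero_smul, sub_zero]; rw [← h, hz'])
    rw [zero_smul, sub_zero] at h2
    rw [h, h2]
  · intro L hL
    obtain ⟨l, hl, hli, y, hy⟩ := i1 L hL
    let D0 : V →ₗ[K] V := H.i ∘ₗ l ∘ₗ H.p
    have hD0i : ∀ r, H.p r = 0 → ∀ x, ⁅r, D0 x⁆ = D0 ⁅r, x⁆ := H.ilp_inv hli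
    have hD0d : ∀ x z, D0 ⁅x, z⁆ = ⁅D0 x, z⁆ + ⁅x, D0 z⁆ := by
      intro x z
      have e : ∀ v, D0 v = L v - ⁅v, y⁆ := fun v => by rw [hy v]; simp [D0]
      simp only [e, hL, sub_lie, lie_sub, lie_lie]
      rw [leibniz_lie x y z, lie_lie x y z, ← lie_skew z ⁅x, y⁆, lie_lie x y z]
      abel
    have hD0u : D0 u = 0 := by simp [D0, hup]
    let P : V →ₗ[K] V →ₗ[K] V := LinearMap.mk₂ K (fun a b => mu a • D0 b - mu b • D0 a)
      (by intros; simp only [map_add]; module) (by intros; simp only [map_smul, smul_eq_mul]; module)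
      (by intros; simp only [map_add]; module) (by intros; simp only [map_smul, smul_eq_mul]; module)
    have hPa : ∀ a b, P a b = mu a • D0 b - mu b • D0 a := fun a b => rfl
    obtain ⟨Q, hQ0, hQi, _, L0, hL0⟩ := i2 P (fun x => by rw [hPa, sub_self])
      (by
        intro a b c
        simp only [d2, lb, hPa, hmub, lie_sub, lie_smul, zero_smul, hD0d]
        rw [← lie_skew (D0 a) b, ← lie_skew (D0 a) c, ← lie_skew (D0 b) c]
        module)
    have hd0 : dd1 L0 = P - H.ext2 Q := by
      ext u v
      rw [LinearMap.sub_apply, LinearMap.sub_apply, hL0, ext2_apply, dd1_apply]; abel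
    obtain ⟨L', hL', hLi'⟩ := H.avg2 L0 (by
      intro r hr x z
      simp only [← dd1_apply, hd0]
      have e2 := H.ext2_inv hQi r hr x z
      simp only [LinearMap.sub_apply, lie_sub, e2, hPa, hmub, lie_smul, hD0i r hr]
      module)
    refine ⟨L' u - y, fun v => ?_⟩
    have h := hL0 u v
    rw [← hL', H.d1_R hLi' hup, hPa, hmuu, hD0u, hup] at h
    simp only [map_zero, LinearMap.zero_apply, smul_zero, sub_zero, one_smul, zero_add] at h
    rw [hy v, sub_lie, ← h, ← lie_skew v y]
    simp only [D0, LinearMap.comp_apply]; abel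

theorem main [IsAlgClosed K] :
    (H.I1 ∧ H.I2i ∧ H.I2s ∧ H.I3) ↔ (H.H1 ∧ H.H2 ∧ H.CC) :=
  ⟨fun ⟨a, b, c, d⟩ => ⟨H.right1 a b, H.right2 c d, H.rightC a c⟩,
   fun ⟨a, b, c⟩ => ⟨H.left1 a c, H.left2i a, H.left2s b c, H.left3 b c⟩⟩

end
end RS

section Wiring

lemma isLin_coe {K M W : Type} [Field K] [AddCommGroup M] [Module K M] [AddCommGroup W]
    [Module K W] (L : M →ₗ[K] W) : IsLinM K L := fun a x y => by simp

lemma isLin_bundle {K M W : Type} [Field K] [AddCommGroup M] [Module K M] [AddCommGroup W]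
    [Module K W] {L : M → W} (h : IsLinM K L) : ∃ L' : M →ₗ[K] W, (L' : M → W) = L := by
  have h0 : L 0 = 0 := by simpa using h 1 0 0
  exact ⟨{ toFun := L
           map_add' := fun x y => by simpa using h 1 x y
           map_smul' := fun c x => by simpa [h0] using h c x 0 }, rfl⟩

lemma isBilin_coe {K M W : Type} [Field K] [AddCommGroup M] [Module K M] [AddCommGroup W]
    [Module K W] (L : M →ₗ[K] M →ₗ[K] W) : IsBilinM K (fun a b => L a b) :=
  ⟨fun a x x' y => by simp, fun a x y y' => by simp⟩

lemma isBilin_bundle {K M W : Type} [Field K] [AddCommGroup M] [Module K M] [AddCommGroup W]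
    [Module K W] {L : M → M → W} (h : IsBilinM K L) :
    ∃ L' : M →ₗ[K] M →ₗ[K] W, (fun a b => L' a b) = L := by
  have h1 : ∀ y, L 0 y = 0 := fun y => by simpa using h.1 1 0 0 y
  have h2 : ∀ y, L y 0 = 0 := fun y => by simpa using h.2 1 y 0 0
  exact ⟨LinearMap.mk₂ K L (fun x x' y => by simpa using h.1 1 x x' y)
    (fun c x y => by simpa [h1] using h.1 c x 0 y)
    (fun x y y' => by simpa using h.2 1 x y y')
    (fun c x y => by simpa [h2] using h.2 c x y 0), rfl⟩

/-- A Lie ring structure from an alternating bilinear map with the Jacobi identity. -/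
abbrev mkLR {K V : Type} [Field K] [AddCommGroup V] [Module K V] (b : V → V → V)
    (hbil : IsBilinM K b) (halt : ∀ x, b x x = 0)
    (hjac : ∀ x y z, b (b x y) z + b (b y z) x + b (b z x) y = 0) : LieRing V :=
  { (inferInstance : AddCommGroup V) with
    bracket := b
    add_lie := fun x y z => by simpa using hbil.1 1 x y z
    lie_add := fun x y z => by simpa using hbil.2 1 x y z
    lie_self := halt
    leibniz_lie := by
      have hadd : ∀ x y z, b (x + y) z = b x z + b y z := fun x y z => by
        simpa using hbil.1 1 x y z
      have hadd2 : ∀ x y z, b x (y + z) = b x y + b x z := fun x y z => by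
        simpa using hbil.2 1 x y z
      have hskew : ∀ x y, b x y = - b y x := by
        intro x y
        have := halt (x + y)
        rw [hadd, hadd2, hadd2, halt, halt, zero_add, add_zero] at this
        exact eq_neg_of_add_eq_zero_left this
      have hneg : ∀ x y, b (-x) y = - b x y := by
        intro x y
        have := hadd x (-x) y
        have h0 : b 0 y = 0 := by simpa using hbil.1 1 0 0 y
        rw [add_neg_cancel, h0] at this
        exact (neg_eq_of_add_eq_zero_right this.symm).symm
      intro x y z
      have h := hjac x y z
      change b x (b y z) = b (b x y) z + b y (b x z)
      rw [hskew x (b y z), hskew y (b x z), hskew x z, hneg]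
      rw [neg_neg, ← sub_eq_zero, ← neg_eq_zero]
      refine Eq.trans ?_ h
      abel }

lemma R_ext {K W : Type} [Field K] [AddCommGroup W] [Module K W] {m n : ℕ} (hnm : n ≤ m)
    (A B : (Fin m → K) → W) (hA : IsLinM K A) (hB : IsLinM K B)
    (h : ∀ l : Fin m, n ≤ (l : ℕ) → A (Pi.single l 1) = B (Pi.single l 1))
    (r : Fin m → K) (hr : restFun K n hnm r = 0) : A r = B r := by
  obtain ⟨A, rfl⟩ := isLin_bundle hA
  obtain ⟨B, rfl⟩ := isLin_bundle hB
  have hs : r = ∑ l, r l • Pi.single l (1 : K) := by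
    ext k
    simp [Finset.sum_apply, Pi.single_apply]
  rw [hs, map_sum, map_sum]
  refine Finset.sum_congr rfl fun l _ => ?_
  rw [map_smul, map_smul]
  by_cases hl : n ≤ (l : ℕ)
  · rw [h l hl]
  · have : r l = 0 := congrFun hr ⟨l, not_le.1 hl⟩
    rw [this, zero_smul, zero_smul]

lemma rest_single {K : Type} [Field K] {m n : ℕ} (hnm : n ≤ m) (l : Fin m) (hl : n ≤ (l : ℕ)) :
    restFun K n hnm (Pi.single l (1 : K)) = 0 := by
  ext k
  simp only [restFun, Pi.zero_apply]
  rw [Pi.single_apply, if_neg]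
  intro h
  have := congrArg Fin.val h
  have hk := k.2
  simp at this
  omega

lemma rest_zero_iff {K : Type} [Field K] {m n : ℕ} (hnm : n ≤ m) (v : Fin m → K) :
    restFun K n hnm v = 0 ↔ ∀ k : Fin m, (k : ℕ) < n → v k = 0 := by
  constructor
  · intro h k hk
    exact congrFun h ⟨k, hk⟩
  · intro h
    ext k
    exact h _ k.2

lemma incl_rest {K : Type} [Field K] {m n : ℕ} (hnm : n ≤ m) (v : Fin m → K)
    (hv : ∀ k : Fin m, n ≤ (k : ℕ) → v k = 0) : inclFun K m n (restFun K n hnm v) = v := by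
  ext k
  simp only [inclFun, restFun]
  split_ifs with h
  · rfl
  · exact (hv k (not_lt.1 h)).symm

lemma rest_incl {K : Type} [Field K] {m n : ℕ} (hnm : n ≤ m) (v : Fin n → K) :
    restFun K n hnm (inclFun K m n v) = v := by
  ext k
  simp [inclFun, restFun]

def inclL (K : Type) [Field K] (m n : ℕ) : (Fin n → K) →ₗ[K] (Fin m → K) :=
  { toFun := inclFun K m n
    map_add' := fun x y => by ext k; simp only [inclFun, Pi.add_apply]; split_ifs <;> simp
    map_smul' := fun c x => by
      ext k; simp only [inclFun, Pi.smul_apply, RingHom.id_apply]; split_ifs <;> simp }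

def restL (K : Type) [Field K] {m : ℕ} (n : ℕ) (hnm : n ≤ m) : (Fin m → K) →ₗ[K] (Fin n → K) :=
  { toFun := restFun K n hnm
    map_add' := fun x y => rfl
    map_smul' := fun c x => rfl }

end Wiring

/-- For `g = R ⋉ n` algebraic (modelled on `K^m` with `n = K^n` the
nilpotent radical on the first `n` coordinates and `R` on the rest, `R = U ⊕ S`,
`S = [R,R]` semisimple, `U` the center of `R`, `R` acting semisimply on `g` by the
adjoint action), the maps `ī_q` induced by extension by zero satisfy (`ī₁` surjective,
`ī₂` bijective, `ī₃` injective) iff `H¹(n,g/n)^R = 0 = H²(n,g/n)^R` and, in addition,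
either `U = 0`, or `U ≠ 0` and `g` is complete. -/
theorem stmt_1 {K : Type} [Field K] [CharZero K] [IsAlgClosed K] {m n : ℕ}
    (hnm : n ≤ m)
    (φ₀ : (Fin m → K) → (Fin m → K) → (Fin m → K))
    (hbil : IsBilinM K φ₀) (halt : ∀ x, φ₀ x x = 0)
    (hjac : ∀ x y z, φ₀ (φ₀ x y) z + φ₀ (φ₀ y z) x + φ₀ (φ₀ z x) y = 0)
    -- `n` is an ideal and `R` a Lie subalgebra
    (hNideal : ∀ x y : Fin m → K, (∀ k : Fin m, n ≤ (k : ℕ) → y k = 0) →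
      ∀ k : Fin m, n ≤ (k : ℕ) → φ₀ x y k = 0)
    (hRsub : ∀ x y : Fin m → K, (∀ k : Fin m, (k : ℕ) < n → x k = 0) →
      (∀ k : Fin m, (k : ℕ) < n → y k = 0) → ∀ k : Fin m, (k : ℕ) < n → φ₀ x y k = 0)
    -- `n` is nilpotent, and is the largest nilpotent ideal of `g`
    (hNnilp : ∃ c : ℕ, ∀ x : ℕ → (Fin m → K),
      (∀ i, ∀ k : Fin m, n ≤ (k : ℕ) → x i k = 0) → leftBrF φ₀ c x = 0)
    (hNmax : ∀ W : Submodule K (Fin m → K),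
      (∀ x : Fin m → K, ∀ w ∈ W, φ₀ x w ∈ W) →
      (∃ c : ℕ, ∀ x : ℕ → (Fin m → K), (∀ i, x i ∈ W) → leftBrF φ₀ c x = 0) →
      ∀ w ∈ W, ∀ k : Fin m, n ≤ (k : ℕ) → w k = 0)
    -- `R` acts semisimply on `g` via the adjoint action
    (hss : ∀ W : Submodule K (Fin m → K),
      (∀ l : Fin m, n ≤ (l : ℕ) → ∀ x ∈ W, φ₀ (Pi.single l 1) x ∈ W) →
      ∃ W' : Submodule K (Fin m → K), IsCompl W W' ∧
        ∀ l : Fin m, n ≤ (l : ℕ) → ∀ x ∈ W', φ₀ (Pi.single l 1) x ∈ W') :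
    -- `U` := the center of `R`, `S` := `[R,R]`
    ∀ USet : Set (Fin m → K),
    (USet = {u | (∀ k : Fin m, (k : ℕ) < n → u k = 0) ∧
      ∀ s : Fin m → K, (∀ k : Fin m, (k : ℕ) < n → s k = 0) → φ₀ u s = 0}) →
    ∀ DerR : Submodule K (Fin m → K),
    (DerR = Submodule.span K {z | ∃ u v : Fin m → K,
      (∀ k : Fin m, (k : ℕ) < n → u k = 0) ∧ (∀ k : Fin m, (k : ℕ) < n → v k = 0) ∧
      z = φ₀ u v}) →
    -- `R = U ⊕ S`, with `S` semisimple (no nonzero abelian ideal)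
    (∀ r : Fin m → K, (∀ k : Fin m, (k : ℕ) < n → r k = 0) →
      ∃ u ∈ USet, ∃ s ∈ DerR, r = u + s) →
    (∀ x ∈ USet, x ∈ DerR → x = 0) →
    (∀ W : Submodule K (Fin m → K), W ≤ DerR →
      (∀ s ∈ DerR, ∀ w ∈ W, φ₀ s w ∈ W) →
      (∀ w ∈ W, ∀ w' ∈ W, φ₀ w w' = 0) → W = ⊥) →
    -- `φ₀' = φ₀|_{n×n}`, `δ_l = ad(e_l)|_n`, and `ρ_l` the action of `R` on `g/n`
    ∀ φ₀' : (Fin n → K) → (Fin n → K) → (Fin n → K),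
    (∀ x y, φ₀' x y = restFun K n hnm (φ₀ (inclFun K m n x) (inclFun K m n y))) →
    ∀ δK : Fin m → (Fin n → K) → (Fin n → K),
    (∀ (l : Fin m) (x : Fin n → K),
      δK l x = restFun K n hnm (φ₀ (Pi.single l 1) (inclFun K m n x))) →
    ∀ ρ : Fin m → (Fin m → K) → (Fin m → K),
    (∀ (l : Fin m) (v : Fin m → K) (k : Fin m),
      ρ l v k = if n ≤ (k : ℕ) then φ₀ (Pi.single l 1) v k else 0) →
    -- the equivalence
    (( -- `ī₁` is surjective
      (∀ L : (Fin m → K) → (Fin m → K), IsLinM K L →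
        (∀ x y, L (φ₀ x y) = φ₀ (L x) y + φ₀ x (L y)) →
        ∃ l : (Fin n → K) → (Fin n → K), IsLinM K l ∧
          (∀ x y, l (φ₀' x y) = φ₀' (l x) y + φ₀' x (l y)) ∧
          (∀ l' : Fin m, n ≤ (l' : ℕ) → ∀ x, δK l' (l x) = l (δK l' x)) ∧
          ∃ yv : Fin m → K, ∀ v, L v
            = inclFun K m n (l (restFun K n hnm v)) + φ₀ v yv) ∧
      -- `ī₂` is injective
      (∀ ψ : (Fin n → K) → (Fin n → K) → (Fin n → K),
        IsBilinM K ψ → (∀ x, ψ x x = 0) →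
        (∀ l : Fin m, n ≤ (l : ℕ) → ∀ x y,
          δK l (ψ x y) = ψ (δK l x) y + ψ x (δK l y)) →
        (∀ x y z, d2 φ₀' ψ x y z = 0) →
        (∃ Λ : (Fin m → K) → (Fin m → K), IsLinM K Λ ∧ ∀ u v,
          inclFun K m n (ψ (restFun K n hnm u) (restFun K n hnm v)) = d1 φ₀ Λ u v) →
        ∃ l : (Fin n → K) → (Fin n → K), IsLinM K l ∧
          (∀ l' : Fin m, n ≤ (l' : ℕ) → ∀ x, δK l' (l x) = l (δK l' x)) ∧
          ∀ x y, ψ x y = d1 φ₀' l x y) ∧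
      -- `ī₂` is surjective
      (∀ Ψ : (Fin m → K) → (Fin m → K) → (Fin m → K),
        IsBilinM K Ψ → (∀ x, Ψ x x = 0) → (∀ x y z, d2 φ₀ Ψ x y z = 0) →
        ∃ ψ : (Fin n → K) → (Fin n → K) → (Fin n → K),
          IsBilinM K ψ ∧ (∀ x, ψ x x = 0) ∧
          (∀ l : Fin m, n ≤ (l : ℕ) → ∀ x y,
            δK l (ψ x y) = ψ (δK l x) y + ψ x (δK l y)) ∧
          (∀ x y z, d2 φ₀' ψ x y z = 0) ∧
          ∃ Λ : (Fin m → K) → (Fin m → K), IsLinM K Λ ∧ ∀ u v, Ψ u v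
            = inclFun K m n (ψ (restFun K n hnm u) (restFun K n hnm v))
              + d1 φ₀ Λ u v) ∧
      -- `ī₃` is injective
      (∀ χ : (Fin n → K) → (Fin n → K) → (Fin n → K) → (Fin n → K),
        IsTrilinM K χ → (∀ x y z, (x = y ∨ y = z ∨ x = z) → χ x y z = 0) →
        (∀ l : Fin m, n ≤ (l : ℕ) → ∀ x y z,
          δK l (χ x y z) = χ (δK l x) y z + χ x (δK l y) z + χ x y (δK l z)) →
        (∀ x y z w, d3 φ₀' χ x y z w = 0) →
        (∃ Ψ : (Fin m → K) → (Fin m → K) → (Fin m → K),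
          IsBilinM K Ψ ∧ (∀ x, Ψ x x = 0) ∧ ∀ u v w,
            inclFun K m n
                (χ (restFun K n hnm u) (restFun K n hnm v) (restFun K n hnm w))
              = d2 φ₀ Ψ u v w) →
        ∃ ψ : (Fin n → K) → (Fin n → K) → (Fin n → K),
          IsBilinM K ψ ∧ (∀ x, ψ x x = 0) ∧
          (∀ l : Fin m, n ≤ (l : ℕ) → ∀ x y,
            δK l (ψ x y) = ψ (δK l x) y + ψ x (δK l y)) ∧
          ∀ x y z, χ x y z = d2 φ₀' ψ x y z))
      ↔
      ( -- `H¹(n, g/n)^R = 0`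
        (∀ f : (Fin n → K) → (Fin m → K), IsLinM K f →
          (∀ x, ∀ k : Fin m, (k : ℕ) < n → f x k = 0) →
          (∀ l : Fin m, n ≤ (l : ℕ) → ∀ x, ρ l (f x) = f (δK l x)) →
          (∀ x y, f (φ₀' x y) = 0) →
          ∀ x, f x = 0) ∧
        -- `H²(n, g/n)^R = 0`
        (∀ F : (Fin n → K) → (Fin n → K) → (Fin m → K),
          IsBilinM K F → (∀ x, F x x = 0) →
          (∀ x y, ∀ k : Fin m, (k : ℕ) < n → F x y k = 0) →
          (∀ l : Fin m, n ≤ (l : ℕ) → ∀ x y,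
            ρ l (F x y) = F (δK l x) y + F x (δK l y)) →
          (∀ x y z, F (φ₀' x y) z - F (φ₀' x z) y + F (φ₀' y z) x = 0) →
          ∃ f : (Fin n → K) → (Fin m → K), IsLinM K f ∧
            (∀ x, ∀ k : Fin m, (k : ℕ) < n → f x k = 0) ∧
            (∀ l : Fin m, n ≤ (l : ℕ) → ∀ x, ρ l (f x) = f (δK l x)) ∧
            ∀ x y, F x y = -f (φ₀' x y)) ∧
        -- `U = 0`, or `U ≠ 0` and `g` is complete
        ((∀ u ∈ USet, u = 0) ∨
          ((∃ u ∈ USet, u ≠ 0) ∧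
            ((∀ x : Fin m → K, (∀ y, φ₀ x y = 0) → x = 0) ∧
              (∀ L : (Fin m → K) → (Fin m → K), IsLinM K L →
                (∀ x y, L (φ₀ x y) = φ₀ (L x) y + φ₀ x (L y)) →
                ∃ y : Fin m → K, ∀ x, L x = φ₀ y x)))))) := by
  intro USet hUSet DerR hDerR hUD hUD0 hDs φ₀' hφ' δK hδ ρ hρ
  letI LR : LieRing (Fin m → K) := mkLR φ₀ hbil halt hjac
  letI LA : LieAlgebra K (Fin m → K) :=
    { lie_smul := fun c x y => by
        have h0 : φ₀ x 0 = 0 := by simpa using hbil.2 1 x 0 0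
        have := hbil.2 c x y 0
        rw [h0, add_zero, add_zero] at this
        exact this }
  have hp : ∀ v : Fin m → K, restFun K n hnm v = 0 ↔ ∀ k : Fin m, (k : ℕ) < n → v k = 0 :=
    rest_zero_iff hnm
  have hst : ∀ W : Submodule K (Fin m → K),
      (∀ l : Fin m, n ≤ (l : ℕ) → ∀ x ∈ W, φ₀ (Pi.single l 1) x ∈ W) →
      ∀ r, restFun K n hnm r = 0 → ∀ x ∈ W, φ₀ r x ∈ W := by
    intro W hW r hr x hx
    have h := R_ext hnm (fun r => W.mkQ (φ₀ r x)) (fun _ => 0)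
      (fun a r s => by simp only [hbil.1, map_add, map_smul])
      (fun a r s => by simp)
      (fun l hl => by
        simp only [Submodule.mkQ_apply, Submodule.Quotient.mk_eq_zero]
        exact hW l hl x hx) r hr
    simpa only [Submodule.mkQ_apply, Submodule.Quotient.mk_eq_zero] using h
  let H : RS K (Fin m → K) (Fin n → K) :=
    { i := inclL K m n
      p := restL K n hnm
      U := USet
      D := DerR
      pi := rest_incl hnm
      hid := fun x y => incl_rest hnm _ (hNideal x _ (fun k hk => by
        change inclFun K m n y k = 0
        simp only [inclFun]
        rw [dif_neg (not_lt.2 hk)]))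
      hR := fun r s hr hs => (hp _).2 (hRsub r s ((hp r).1 hr) ((hp s).1 hs))
      hU := fun u => by
        rw [hUSet]
        exact and_congr (hp u).symm (forall_congr' fun s => imp_congr (hp s).symm Iff.rfl)
      hD := by
        rw [hDerR]
        congr 1
        ext z
        exact exists_congr fun u => exists_congr fun v =>
          and_congr (hp u).symm (and_congr (hp v).symm Iff.rfl)
      hUD := fun r hr => hUD r ((hp r).1 hr)
      hUD0 := hUD0
      hDs := hDs
      hss := fun W hW => by
        obtain ⟨W', h1, h2⟩ := hss W
          (fun l hl x hx => hW _ (rest_single hnm l hl) x hx)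
        exact ⟨W', h1, hst W' h2⟩ }
  have hsing : ∀ l : Fin m, n ≤ (l : ℕ) → H.p (Pi.single l 1) = 0 :=
    fun l hl => rest_single hnm l hl
  obtain rfl : φ₀' = H.br := by funext x y; exact hφ' x y
  obtain rfl : δK = fun l => H.dl (Pi.single l 1) := by funext l x; exact hδ l x
  have hdl : ∀ (a : K) r s x, H.dl (a • r + s) x = a • H.dl r x + H.dl s x := by
    intro a r s x
    change H.p (φ₀ (a • r + s) (H.i x)) = a • H.p (φ₀ r (H.i x)) + H.p (φ₀ s (H.i x))
    rw [hbil.1, map_add, map_smul]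
  have hρ' : ∀ l : Fin m, n ≤ (l : ℕ) → ∀ v, H.p v = 0 → ρ l v = φ₀ (Pi.single l 1) v := by
    intro l hl v hv
    ext k
    rw [hρ]
    split_ifs with h
    · rfl
    · exact ((hp _).1 (H.hR _ v (hsing l hl) hv) k (not_le.1 h)).symm
  have cInv1 : ∀ l : (Fin n → K) →ₗ[K] (Fin n → K), (∀ l' : Fin m, n ≤ (l' : ℕ) → ∀ x,
      H.dl (Pi.single l' 1) (l x) = l (H.dl (Pi.single l' 1) x)) ↔ H.Inv1 l := by
    intro l
    refine ⟨fun h r hr x => ?_, fun h l' hl' x => h _ (hsing l' hl') x⟩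
    exact R_ext hnm (fun r => H.dl r (l x)) (fun r => l (H.dl r x))
      (fun a r s => by simp only [hdl])
      (fun a r s => by simp only [hdl, map_add, map_smul]) (fun l' hl' => h l' hl' x) r hr
  have cInv2 : ∀ P : (Fin n → K) →ₗ[K] (Fin n → K) →ₗ[K] (Fin n → K),
      (∀ l : Fin m, n ≤ (l : ℕ) → ∀ x y, H.dl (Pi.single l 1) (P x y)
        = P (H.dl (Pi.single l 1) x) y + P x (H.dl (Pi.single l 1) y)) ↔ H.Inv2 P := by
    intro P
    refine ⟨fun h r hr x y => ?_, fun h l' hl' x => h _ (hsing l' hl') x⟩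
    exact R_ext hnm (fun r => H.dl r (P x y)) (fun r => P (H.dl r x) y + P x (H.dl r y))
      (fun a r s => by simp only [hdl])
      (fun a r s => by
        simp only [hdl, map_add, map_smul, LinearMap.add_apply, LinearMap.smul_apply]; module)
      (fun l' hl' => h l' hl' x y) r hr
  have e1 := H.main
  refine Iff.trans ?_ (Iff.trans e1 ?_)
  · refine and_congr ?_ (and_congr ?_ (and_congr ?_ ?_))
    · constructor
      · intro h L hL
        obtain ⟨l, hl, h1, h2, y, hy⟩ := h L (isLin_coe L) hL
        obtain ⟨l, rfl⟩ := isLin_bundle hl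
        exact ⟨l, h1, (cInv1 l).1 h2, y, hy⟩
      · intro h L hL hd
        obtain ⟨L, rfl⟩ := isLin_bundle hL
        obtain ⟨l, h1, h2, y, hy⟩ := h L hd
        exact ⟨l, isLin_coe l, h1, (cInv1 l).2 h2, y, hy⟩
    · constructor
      · rintro h P ha hi hc ⟨L, hL⟩
        obtain ⟨l, hl, h2, hy⟩ := h (fun a b => P a b) (isBilin_coe P) ha ((cInv2 P).2 hi) hc
          ⟨L, isLin_coe L, hL⟩
        obtain ⟨l, rfl⟩ := isLin_bundle hl
        exact ⟨l, (cInv1 l).1 h2, hy⟩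
      · rintro h P hP ha hi hc ⟨L, hL, hL'⟩
        obtain ⟨L, rfl⟩ := isLin_bundle hL
        obtain ⟨P, rfl⟩ := isBilin_bundle hP
        obtain ⟨l, h2, hy⟩ := h P ha ((cInv2 P).1 hi) hc ⟨L, hL'⟩
        exact ⟨l, isLin_coe l, (cInv1 l).2 h2, hy⟩
    · constructor
      · rintro h P ha hc
        obtain ⟨Q, hQ, h1, h2, h3, L, hL, hL'⟩ := h (fun a b => P a b) (isBilin_coe P) ha hc
        obtain ⟨L, rfl⟩ := isLin_bundle hL
        obtain ⟨Q, rfl⟩ := isBilin_bundle hQ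
        exact ⟨Q, h1, (cInv2 Q).1 h2, h3, L, hL'⟩
      · rintro h P hP ha hc
        obtain ⟨P, rfl⟩ := isBilin_bundle hP
        obtain ⟨Q, h1, h2, h3, L, hL'⟩ := h P ha hc
        exact ⟨fun a b => Q a b, isBilin_coe Q, h1, (cInv2 Q).2 h2, h3, L, isLin_coe L, hL'⟩
    · constructor
      · rintro h X hX ha hi hc ⟨P, hP, hP'⟩
        obtain ⟨Q, hQ, h1, h2, h3⟩ := h X hX ha
          (fun l hl x y z => hi _ (hsing l hl) x y z) hc
          ⟨fun a b => P a b, isBilin_coe P, hP, hP'⟩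
        obtain ⟨Q, rfl⟩ := isBilin_bundle hQ
        exact ⟨Q, h1, (cInv2 Q).1 h2, h3⟩
      · rintro h X hX ha hi hc ⟨P, hP, hP', hP''⟩
        obtain ⟨P, rfl⟩ := isBilin_bundle hP
        obtain ⟨Q, h1, h2, h3⟩ := h X hX ha
          (fun r hr x y z => R_ext hnm (fun r => H.dl r (X x y z))
            (fun r => X (H.dl r x) y z + X x (H.dl r y) z + X x y (H.dl r z))
            (fun a r s => by simp only [hdl])
            (fun a r s => by
              simp only [hdl, hX.1, hX.2.1, hX.2.2]; module)
            (fun l' hl' => hi l' hl' x y z) r hr) hc ⟨P, hP', hP''⟩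
        exact ⟨fun a b => Q a b, isBilin_coe Q, h1, (cInv2 Q).2 h2, h3⟩
  · refine and_congr ?_ (and_congr ?_ ?_)
    · constructor
      · intro h f hf hfp hfi hfb
        obtain ⟨f, rfl⟩ := isLin_bundle hf
        have hfp' : ∀ x, H.p (f x) = 0 := fun x => (hp _).2 (hfp x)
        refine h f hfp' (fun r hr x => ?_) hfb
        exact R_ext hnm (fun r => φ₀ r (f x)) (fun r => f (H.dl r x))
          (fun a r s => by simp only [hbil.1])
          (fun a r s => by simp only [hdl, map_add, map_smul])
          (fun l' hl' => by
            rw [← hρ' l' hl' _ (hfp' x)]; exact hfi l' hl' x) r hr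
      · intro h f hfp hfi hfb
        exact h f (isLin_coe f) (fun x => (hp _).1 (hfp x))
          (fun l hl x => by rw [hρ' l hl _ (hfp x)]; exact hfi _ (hsing l hl) x) hfb
    · constructor
      · intro h F hF ha hFp hFi hFb
        obtain ⟨F, rfl⟩ := isBilin_bundle hF
        have hFp' : ∀ x y, H.p (F x y) = 0 := fun x y => (hp _).2 (hFp x y)
        obtain ⟨f, h1, h2, h3⟩ := h F ha hFp' (fun r hr x y =>
          R_ext hnm (fun r => φ₀ r (F x y)) (fun r => F (H.dl r x) y + F x (H.dl r y))
          (fun a r s => by simp only [hbil.1])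
          (fun a r s => by
            simp only [hdl, map_add, map_smul, LinearMap.add_apply, LinearMap.smul_apply]; module)
          (fun l' hl' => by
            rw [← hρ' l' hl' _ (hFp' x y)]; exact hFi l' hl' x y) r hr) hFb
        exact ⟨f, isLin_coe f, fun x => (hp _).1 (h1 x),
          fun l hl x => by rw [hρ' l hl _ (h1 x)]; exact h2 _ (hsing l hl) x, h3⟩
      · intro h F ha hFp hFi hFb
        obtain ⟨f, hf, h1, h2, h3⟩ := h (fun a b => F a b) (isBilin_coe F) ha
          (fun x y => (hp _).1 (hFp x y))
          (fun l hl x y => by rw [hρ' l hl _ (hFp x y)]; exact hFi _ (hsing l hl) x y) hFb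
        obtain ⟨f, rfl⟩ := isLin_bundle hf
        have hfp' : ∀ x, H.p (f x) = 0 := fun x => (hp _).2 (h1 x)
        refine ⟨f, hfp', fun r hr x => ?_, h3⟩
        exact R_ext hnm (fun r => φ₀ r (f x)) (fun r => f (H.dl r x))
          (fun a r s => by simp only [hbil.1])
          (fun a r s => by simp only [hdl, map_add, map_smul])
          (fun l' hl' => by
            rw [← hρ' l' hl' _ (hfp' x)]; exact h2 l' hl' x) r hr
    · refine or_congr Iff.rfl (and_congr Iff.rfl (and_congr Iff.rfl ?_))
      constructor
      · intro h L hL hd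
        obtain ⟨L, rfl⟩ := isLin_bundle hL
        exact h L hd
      · intro h L hd
        exact h L (isLin_coe L) hd

end Stmt1
end

section
/- Let K be an algebraically closed field of characteristic 0, g = (V, φ₀) a finite-dimensional Lie algebra with V = K^m, 𝒜 an admissible set at φ₀, W¹ ⊆ End_K(V) a linear complement of Z¹(g,g) = Der(g) in End_K(V), and A a Noetherian complete local K-algebra with maximal ideal 𝔪 and residue field K. Then the map F(w, φ) := (id+w)∘φ∘((id+w)⁻¹ × (id+w)⁻¹) is a bijection from (𝔪⊗W¹) × Def_𝒜(φ₀,A) onto Def(φ₀,A), where Def(φ₀,A) is the set of deformations of φ₀ with base A and Def_𝒜(φ₀,A) is the subset of those deformations φ whose coordinate φ^α ∈ A in the basis (e_k^{ij}) equals (φ₀)^α·1_A for every α ∈ 𝒜. -/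
section Stmt3

/-- Bilinearity of a raw map over a commutative ring. -/
def IsBilin (A : Type) [CommRing A] {M : Type} [AddCommGroup M] [Module A M]
    (f : M → M → M) : Prop :=
  (∀ (a : A) (x x' y : M), f (a • x + x') y = a • f x y + f x' y) ∧
  (∀ (a : A) (x y y' : M), f x (a • y + y') = a • f x y + f x y')

/-- Linearity of a raw map. -/
def IsLin (A : Type) [CommRing A] {M : Type} [AddCommGroup M] [Module A M]
    (L : M → M) : Prop :=
  ∀ (a : A) (x y : M), L (a • x + y) = a • L x + L y

/-- The basis 2-cochain `e_k^{ij}` of `C²(K^m, K^m)`. -/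
def ekij {K : Type} [Field K] {m : ℕ} (i j k : Fin m) :
    (Fin m → K) → (Fin m → K) → (Fin m → K) :=
  fun x y => (x i * y j - x j * y i) • (Pi.single k 1 : Fin m → K)

/-- The 2-coboundary `dL` of `L ∈ C¹`, for the bracket `φ₀`. -/
def cob {K : Type} [Field K] {m : ℕ}
    (φ₀ : (Fin m → K) → (Fin m → K) → (Fin m → K)) (L : (Fin m → K) → (Fin m → K)) :
    (Fin m → K) → (Fin m → K) → (Fin m → K) :=
  fun x y => φ₀ x (L y) - φ₀ y (L x) - L (φ₀ x y)

/-- `id + W`, for a matrix `W` over `A`. -/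
def matMap {A : Type} [CommRing A] {m : ℕ} (W : Fin m → Fin m → A) (x : Fin m → A) :
    Fin m → A :=
  fun k => x k + ∑ j : Fin m, W k j * x j

/-- A deformation of `φ₀` with base `A`: an `A`-bilinear alternating Jacobi bracket on
`A ⊗ K^m` reducing to `φ₀` modulo the maximal ideal (via `pr`). -/
def IsDef {K : Type} [Field K] {m : ℕ}
    (φ₀ : (Fin m → K) → (Fin m → K) → (Fin m → K))
    (A : Type) [CommRing A] [Algebra K A] (pr : A →ₐ[K] K)
    (φ : (Fin m → A) → (Fin m → A) → (Fin m → A)) : Prop :=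
  IsBilin A φ ∧ (∀ x, φ x x = 0) ∧
  (∀ x y z, φ (φ x y) z + φ (φ y z) x + φ (φ z x) y = 0) ∧
  (∀ i j k : Fin m, pr (φ (Pi.single i 1) (Pi.single j 1) k)
    = φ₀ (Pi.single i 1) (Pi.single j 1) k)

theorem IsLin.exists_lin {A : Type} [CommRing A] {M : Type} [AddCommGroup M] [Module A M]
    {L : M → M} (h : IsLin A L) : ∃ l : M →ₗ[A] M, ∀ x, l x = L x := by
  have h0 : L 0 = 0 := by simpa using h 1 0 0
  exact ⟨{ toFun := L, map_add' := fun x y => by simpa using h 1 x y,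
           map_smul' := fun a x => by simpa [h0] using h a x 0 }, fun x => rfl⟩

theorem isLin_of_lin {A : Type} [CommRing A] {M : Type} [AddCommGroup M] [Module A M]
    (l : M →ₗ[A] M) : IsLin A (fun x => l x) := fun a x y => by simp

theorem IsBilin.exists_bilin {A : Type} [CommRing A] {M : Type} [AddCommGroup M] [Module A M]
    {f : M → M → M} (h : IsBilin A f) : ∃ B : M →ₗ[A] M →ₗ[A] M, ∀ x y, B x y = f x y := by
  have h0 : ∀ y, f 0 y = 0 := fun y => by simpa using h.1 1 0 0 y
  have h0' : ∀ y, f y 0 = 0 := fun y => by simpa using h.2 1 y 0 0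
  refine ⟨LinearMap.mk₂ A f (fun x x' y => by simpa using h.1 1 x x' y)
    (fun a x y => by simpa [h0] using h.1 a x 0 y) (fun x y y' => by simpa using h.2 1 x y y')
    (fun a x y => by simpa [h0'] using h.2 a x y 0), fun x y => rfl⟩

theorem isBilin_of_bilin {A : Type} [CommRing A] {M : Type} [AddCommGroup M] [Module A M]
    (B : M →ₗ[A] M →ₗ[A] M) : IsBilin A (fun x y => B x y) :=
  ⟨fun a x x' y => by simp, fun a x y y' => by simp⟩

theorem alt_neg {A : Type} [CommRing A] {M : Type} [AddCommGroup M] [Module A M]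
    (B : M →ₗ[A] M →ₗ[A] M) (h : ∀ x, B x x = 0) (x y : M) : B x y = - B y x := by
  have := h (x + y)
  simp only [map_add, LinearMap.add_apply, h, zero_add, add_zero] at this
  exact eq_neg_of_add_eq_zero_right this

theorem ekij_basis {K : Type} [Field K] {m : ℕ} {i j k a b c : Fin m} (hij : i < j) (hab : a < b) :
    ekij (K := K) i j k (Pi.single a 1) (Pi.single b 1) c
      = if (i, j, k) = (a, b, c) then 1 else 0 := by
  unfold ekij
  simp only [Pi.smul_apply, smul_eq_mul, Pi.single_apply, Prod.mk.injEq]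
  by_cases h1 : i = a
  · subst h1
    by_cases h2 : j = b
    · subst h2
      have : j ≠ i := hij.ne'
      simp [this, eq_comm]
    · have : j ≠ i := hij.ne'
      simp [h2, this]
  · by_cases h2 : j = a
    · subst h2
      have : i ≠ b := (hij.trans hab).ne
      simp [h1, this]
    · simp [h1, h2]

theorem ekij_exists {K : Type} [Field K] {m : ℕ} (i j k : Fin m) :
    ∃ B : (Fin m → K) →ₗ[K] (Fin m → K) →ₗ[K] (Fin m → K), ∀ x y, B x y = ekij i j k x y := by
  apply IsBilin.exists_bilin
  constructor <;> intros <;> ext l <;> simp [ekij] <;> ring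

theorem alt_ext {K : Type} [Field K] {m : ℕ}
    (B : (Fin m → K) →ₗ[K] (Fin m → K) →ₗ[K] (Fin m → K)) (halt : ∀ x, B x x = 0)
    (h : ∀ a b, a < b → B (Pi.single a 1) (Pi.single b 1) = 0) : B = 0 := by
  refine LinearMap.ext_basis (Pi.basisFun K (Fin m)) (Pi.basisFun K (Fin m)) ?_
  intro a b
  simp only [Pi.basisFun_apply, LinearMap.zero_apply]
  rcases lt_trichotomy a b with hab | hab | hab
  · exact h a b hab
  · subst hab; exact halt _
  · rw [alt_neg B halt, h b a hab, neg_zero]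

theorem mem_span_of_zero {K : Type} [Field K] {m : ℕ} (𝒜 : Set (Fin m × Fin m × Fin m))
    (f : (Fin m → K) → (Fin m → K) → (Fin m → K)) (hf : IsBilin K f) (halt : ∀ x, f x x = 0)
    (h : ∀ α ∈ 𝒜, f (Pi.single α.1 1) (Pi.single α.2.1 1) α.2.2 = 0) :
    f ∈ Submodule.span K
      {f | ∃ i j k : Fin m, i < j ∧ (i, j, k) ∉ 𝒜 ∧ f = ekij (K := K) i j k} := by
  classical
  obtain ⟨B, hB⟩ := hf.exists_bilin
  choose E hE using fun p : Fin m × Fin m × Fin m => ekij_exists (K := K) p.1 p.2.1 p.2.2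
  let s : Finset (Fin m × Fin m × Fin m) := Finset.univ.filter fun p => p.1 < p.2.1
  let co : Fin m × Fin m × Fin m → K := fun p => f (Pi.single p.1 1) (Pi.single p.2.1 1) p.2.2
  have key : B - ∑ p ∈ s, co p • E p = 0 := by
    apply alt_ext
    · intro x
      simp only [LinearMap.sub_apply, LinearMap.sum_apply, LinearMap.smul_apply, hB, halt, hE]
      simp [ekij, mul_comm]
    · intro a b hab
      ext c
      simp only [LinearMap.sub_apply, LinearMap.sum_apply, LinearMap.smul_apply, hB, hE,
        Pi.sub_apply, Finset.sum_apply, Pi.smul_apply, smul_eq_mul, Pi.zero_apply]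
      rw [Finset.sum_eq_single (a, b, c)]
      · rw [ekij_basis hab hab]; simp [co]
      · intro p hp hne
        rw [ekij_basis (by simpa [s] using hp) hab, if_neg hne, mul_zero]
      · intro hn; exact absurd (by simpa [s] using hab) hn
  have hfeq : f = ∑ p ∈ s, co p • ekij (K := K) p.1 p.2.1 p.2.2 := by
    funext x y
    rw [← hB, (sub_eq_zero (a := B) (b := ∑ p ∈ s, co p • E p)).mp key]
    simp only [LinearMap.sum_apply, LinearMap.smul_apply, hE, Finset.sum_apply, Pi.smul_apply]
  rw [hfeq]
  refine Submodule.sum_mem _ fun p hp => ?_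
  by_cases hpA : p ∈ 𝒜
  · have : co p = 0 := h p hpA
    rw [this, zero_smul]; exact Submodule.zero_mem _
  · exact Submodule.smul_mem _ _ (Submodule.subset_span
      ⟨p.1, p.2.1, p.2.2, by simpa [s] using hp, hpA, rfl⟩)

theorem zero_of_mem_span {K : Type} [Field K] {m : ℕ} (𝒜 : Set (Fin m × Fin m × Fin m))
    (h𝒜 : ∀ α ∈ 𝒜, α.1 < α.2.1)
    (f : (Fin m → K) → (Fin m → K) → (Fin m → K))
    (hf : f ∈ Submodule.span K
      {f | ∃ i j k : Fin m, i < j ∧ (i, j, k) ∉ 𝒜 ∧ f = ekij (K := K) i j k}) :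
    ∀ α ∈ 𝒜, f (Pi.single α.1 1) (Pi.single α.2.1 1) α.2.2 = 0 := by
  intro α hα
  induction hf using Submodule.span_induction with
  | mem x hx =>
    obtain ⟨i, j, k, hij, hn, rfl⟩ := hx
    rw [ekij_basis hij (h𝒜 α hα), if_neg]
    intro h; exact hn (h ▸ hα)
  | zero => rfl
  | add x y _ _ hx hy => simp [hx, hy]
  | smul a x _ hx => simp [hx]

theorem cob_sub_sum {K : Type} [Field K] {m : ℕ} {ι : Type} [Fintype ι]
    (B : (Fin m → K) →ₗ[K] (Fin m → K) →ₗ[K] (Fin m → K))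
    (L : (Fin m → K) → (Fin m → K)) (c : ι → K) (w : ι → (Fin m → K) → (Fin m → K)) (x y) :
    cob (fun x y => B x y) (L - ∑ i, c i • w i) x y
      = cob (fun x y => B x y) L x y - ∑ i, c i • cob (fun x y => B x y) (w i) x y := by
  simp only [cob, Pi.sub_apply, Finset.sum_apply, Pi.smul_apply, map_sub, map_sum, map_smul,
    smul_sub, Finset.sum_sub_distrib]
  abel

theorem exists_dual_basis {K : Type} [Field K] {m : ℕ}
    (φ₀ : (Fin m → K) → (Fin m → K) → (Fin m → K))
    (hbil : IsBilin K φ₀) (halt : ∀ x, φ₀ x x = 0)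
    (𝒜 : Set (Fin m × Fin m × Fin m)) [Fintype 𝒜] [DecidableEq 𝒜]
    (h𝒜 : ∀ α ∈ 𝒜, α.1 < α.2.1)
    (hadm1 : ∀ ψ : (Fin m → K) → (Fin m → K) → (Fin m → K),
      IsBilin K ψ → (∀ x, ψ x x = 0) →
      ∃ v ∈ Submodule.span K {f | ∃ i j k : Fin m, i < j ∧ (i, j, k) ∉ 𝒜 ∧ f = ekij i j k},
        ∃ L, IsLin K L ∧ ψ = v + cob φ₀ L)
    (hadm2 : ∀ v ∈ Submodule.span K
        {f | ∃ i j k : Fin m, i < j ∧ (i, j, k) ∉ 𝒜 ∧ f = ekij (K := K) i j k},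
      ∀ L, IsLin K L → v = cob φ₀ L → v = 0)
    (W1 : Submodule K ((Fin m → K) → (Fin m → K)))
    (hW1lin : ∀ L ∈ W1, IsLin K L)
    (hW1a : ∀ L : (Fin m → K) → (Fin m → K), IsLin K L →
      ∃ d, (IsLin K d ∧ ∀ x y, d (φ₀ x y) = φ₀ (d x) y + φ₀ x (d y)) ∧
        ∃ w ∈ W1, L = d + w)
    (hW1b : ∀ w ∈ W1, (∀ x y, w (φ₀ x y) = φ₀ (w x) y + φ₀ x (w y)) → w = 0) :
    ∃ w : 𝒜 → (Fin m → K) → (Fin m → K), (∀ β, w β ∈ W1) ∧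
      (∀ α β : 𝒜, cob φ₀ (w β) (Pi.single α.1.1 1) (Pi.single α.1.2.1 1) α.1.2.2
        = if α = β then 1 else 0) ∧
      ∀ L ∈ W1, ∃ c : 𝒜 → K, L = ∑ β, c β • w β := by
  obtain ⟨B, hB⟩ := hbil.exists_bilin
  obtain rfl : (fun x y => B x y) = φ₀ := by funext x y; exact hB x y
  have hneg := alt_neg B halt
  have hsurj : ∀ β : 𝒜, ∃ w ∈ W1, ∀ α : 𝒜,
      cob (fun x y => B x y) w (Pi.single α.1.1 1) (Pi.single α.1.2.1 1) α.1.2.2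
        = if α = β then 1 else 0 := by
    intro β
    obtain ⟨E, hE⟩ := ekij_exists (K := K) β.1.1 β.1.2.1 β.1.2.2
    have hbE : IsBilin K (ekij (K := K) β.1.1 β.1.2.1 β.1.2.2) := by
      have := isBilin_of_bilin E
      simpa only [hE] using this
    obtain ⟨v, hv, L, hL, heq⟩ := hadm1 _ hbE (fun x => by simp [ekij, mul_comm])
    obtain ⟨d, ⟨hd, hder⟩, w, hw, rfl⟩ := hW1a L hL
    refine ⟨w, hw, fun α => ?_⟩
    have h1 := congrFun (congrFun (congrFun heq (Pi.single α.1.1 1)) (Pi.single α.1.2.1 1)) α.1.2.2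
    rw [ekij_basis (h𝒜 _ β.2) (h𝒜 _ α.2)] at h1
    simp only [Pi.add_apply, zero_of_mem_span 𝒜 h𝒜 v hv α.1 α.2, zero_add] at h1
    have h2 : cob (fun x y => B x y) (d + w) = cob (fun x y => B x y) w := by
      funext x y
      simp only [cob, Pi.add_apply, map_add, hder]
      rw [hneg y (d x)]
      abel
    rw [h2] at h1
    rw [← h1]
    congr 1
    simp [Subtype.ext_iff, eq_comm]
  have hinj : ∀ L ∈ W1, (∀ α ∈ 𝒜,
      cob (fun x y => B x y) L (Pi.single α.1 1) (Pi.single α.2.1 1) α.2.2 = 0) → L = 0 := by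
    intro L hL h
    obtain ⟨l, hl⟩ := (hW1lin L hL).exists_lin
    have hb : IsBilin K (cob (fun x y => B x y) L) := by
      constructor <;> intros <;> simp only [cob, ← hl, map_add, map_smul, LinearMap.add_apply,
        LinearMap.smul_apply, smul_sub] <;> abel
    have ha : ∀ x, cob (fun x y => B x y) L x x = 0 := by
      intro x
      simp [cob, ← hl, halt x]
    have h0 := hadm2 _ (mem_span_of_zero 𝒜 _ hb ha h) L (hW1lin L hL) rfl
    apply hW1b L hL
    intro x y
    have := congrFun (congrFun h0 x) y
    simp only [cob, Pi.zero_apply] at this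
    rw [hneg y (L x), sub_neg_eq_add] at this
    rw [add_comm]
    exact (sub_eq_zero.mp this).symm
  choose w hw hdual using hsurj
  refine ⟨w, hw, fun α β => hdual β α, fun L hL => ?_⟩
  refine ⟨fun β => cob (fun x y => B x y) L (Pi.single β.1.1 1) (Pi.single β.1.2.1 1) β.1.2.2, ?_⟩
  rw [← sub_eq_zero]
  apply hinj
  · exact W1.sub_mem hL (W1.sum_mem fun β _ => W1.smul_mem _ (hw β))
  · intro α hα
    rw [cob_sub_sum]
    simp only [Pi.sub_apply, Finset.sum_apply, Pi.smul_apply, smul_eq_mul]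
    simp only [fun β => hdual β ⟨α, hα⟩]
    simp

theorem contraction {A : Type} [CommRing A] (I : Ideal A) (hI : IsAdicComplete I A) {ι : Type}
    (F : (ι → A) → (ι → A)) (hF : ∀ c, (∀ i, c i ∈ I) → ∀ i, F c i ∈ I)
    (hc : ∀ n : ℕ, ∀ c c' : ι → A, (∀ i, c i ∈ I) → (∀ i, c' i ∈ I) →
      (∀ i, c' i - c i ∈ I ^ (n + 1)) → ∀ i, F c' i - F c i ∈ I ^ (n + 2)) :
    (∃ c, (∀ i, c i ∈ I) ∧ F c = c) ∧
    ∀ c c', (∀ i, c i ∈ I) → (∀ i, c' i ∈ I) → F c = c → F c' = c' → c' = c := by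
  have haus : ∀ x : A, (∀ n : ℕ, x ∈ I ^ (n + 1)) → x = 0 := by
    intro x hx
    apply hI.toIsHausdorff.haus
    intro n
    rw [SModEq.zero]
    simpa using Ideal.pow_le_pow_right (Nat.le_succ n) (hx n)
  constructor
  · let s : ℕ → ι → A := fun n => F^[n] 0
    have hs : ∀ n i, s n i ∈ I := by
      intro n
      induction n with
      | zero => intro i; simp [s]
      | succ n ih =>
        simp only [s, Function.iterate_succ_apply']
        exact hF _ ih
    have hd : ∀ n i, s (n + 1) i - s n i ∈ I ^ (n + 1) := by
      intro n
      induction n with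
      | zero => intro i; simpa using I.sub_mem (hs 1 i) (hs 0 i)
      | succ n ih =>
        have := hc n (s n) (s (n + 1)) (hs _) (hs _) ih
        simpa only [s, Function.iterate_succ_apply'] using this
    have hd2 : ∀ n k i, s (n + k) i - s n i ∈ I ^ n := by
      intro n k i
      induction k with
      | zero => simp
      | succ k ih =>
        have h1 := Ideal.pow_le_pow_right (by omega : n ≤ n + k + 1) (hd (n + k) i)
        have := (I ^ n).add_mem h1 ih
        simpa [add_assoc] using this
    have hlim : ∀ i, ∃ L : A, ∀ n, s n i - L ∈ I ^ n := by
      intro i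
      obtain ⟨L, hL⟩ := hI.toIsPrecomplete.prec (f := fun n => s n i) (by
        intro a b hab
        obtain ⟨k, rfl⟩ := Nat.exists_eq_add_of_le hab
        rw [SModEq.comm, SModEq.sub_mem]
        simpa using hd2 a k i)
      refine ⟨L, fun n => ?_⟩
      have := hL n
      rw [SModEq.sub_mem] at this
      simpa using this
    choose c hcl using hlim
    have hcI : ∀ i, c i ∈ I := fun i => by
      have h1 := hcl i 1
      rw [pow_one] at h1
      have := I.sub_mem (hs 1 i) h1
      simpa using this
    refine ⟨c, hcI, ?_⟩
    funext i
    rw [← sub_eq_zero]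
    apply haus
    intro n
    have h1 : F (s (n + 1)) i - F c i ∈ I ^ (n + 1) := Ideal.pow_le_pow_right (by omega)
      (hc n c (s (n + 1)) hcI (hs _) (fun i => hcl i (n + 1)) i)
    have h2 : F (s (n + 1)) i - c i ∈ I ^ (n + 1) := by
      have := Ideal.pow_le_pow_right (by omega : n + 1 ≤ n + 2) (hcl i (n + 2))
      simpa only [s, Function.iterate_succ_apply'] using this
    have := (I ^ (n + 1)).sub_mem h2 h1
    simpa using this
  · intro c c' h h' hf hf'
    have key : ∀ n i, c' i - c i ∈ I ^ (n + 1) := by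
      intro n
      induction n with
      | zero => intro i; simpa using I.sub_mem (h' i) (h i)
      | succ n ih =>
        have := hc n c c' h h' ih
        simpa only [hf, hf'] using this
    funext i
    exact sub_eq_zero.mp (haus _ fun n => key n i)

/-- Vectors with all coordinates in `J`. -/
def vecIn {A : Type} [CommRing A] (m : ℕ) (J : Ideal A) : Submodule A (Fin m → A) :=
  Submodule.pi Set.univ fun _ => J

theorem mem_vecIn {A : Type} [CommRing A] {m : ℕ} {J : Ideal A} {x : Fin m → A} :
    x ∈ vecIn m J ↔ ∀ i, x i ∈ J := by simp [vecIn]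

theorem vecIn_mono {A : Type} [CommRing A] {m : ℕ} {I J : Ideal A} (h : I ≤ J) :
    vecIn m I ≤ vecIn m J := fun _ hx => mem_vecIn.2 fun i => h (mem_vecIn.1 hx i)

theorem lin_mem {A : Type} [CommRing A] {m : ℕ} {I J : Ideal A}
    (f : (Fin m → A) →ₗ[A] (Fin m → A)) (hf : ∀ x, f x ∈ vecIn m J)
    {x : Fin m → A} (hx : x ∈ vecIn m I) : f x ∈ vecIn m (J * I) := by
  have : f x = ∑ i, x i • f (Pi.single i 1) := by
    conv_lhs => rw [pi_eq_sum_univ' x]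
    simp [Pi.single]
  rw [this]
  refine Submodule.sum_mem _ fun i _ => mem_vecIn.2 fun k => ?_
  rw [Pi.smul_apply, smul_eq_mul, mul_comm (x i)]
  exact Ideal.mul_mem_mul (mem_vecIn.1 (hf _) k) (mem_vecIn.1 hx i)

theorem lin_mem_top {A : Type} [CommRing A] {m : ℕ} {I : Ideal A}
    (f : (Fin m → A) →ₗ[A] (Fin m → A)) 
    {x : Fin m → A} (hx : x ∈ vecIn m I) : f x ∈ vecIn m I := by
  have := lin_mem (J := ⊤) f (fun x => mem_vecIn.2 fun i => trivial) hx
  simpa using this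

section red
variable {K : Type} [Field K] {m : ℕ} {A : Type} [CommRing A] [Algebra K A]

/-- Reduction of vectors. -/
def red (m : ℕ) (pr : A →ₐ[K] K) (x : Fin m → A) : Fin m → K := fun i => pr (x i)

theorem red_add (pr : A →ₐ[K] K) (x y : Fin m → A) : red m pr (x + y) = red m pr x + red m pr y := by
  funext i; simp [red]

theorem red_sub (pr : A →ₐ[K] K) (x y : Fin m → A) : red m pr (x - y) = red m pr x - red m pr y := by
  funext i; simp [red]

theorem mem_vecIn_iff_red [IsLocalRing A] (pr : A →ₐ[K] K)
    (hpr : ∀ a : A, a ∈ IsLocalRing.maximalIdeal A ↔ pr a = 0) (x : Fin m → A) :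
    x ∈ vecIn m (IsLocalRing.maximalIdeal A) ↔ red m pr x = 0 := by
  rw [mem_vecIn, funext_iff]
  exact forall_congr' fun i => hpr _

theorem bilin_expand {A : Type} [CommRing A] (B : (Fin m → A) →ₗ[A] (Fin m → A) →ₗ[A] (Fin m → A))
    (x y : Fin m → A) (k : Fin m) :
    B x y k = ∑ i, ∑ j, x i * (y j * B (Pi.single i 1) (Pi.single j 1) k) := by
  have hx : x = ∑ i, x i • (Pi.single i 1 : Fin m → A) := by
    ext l; simp [Finset.sum_apply, Pi.single_apply]
  have hy : y = ∑ i, y i • (Pi.single i 1 : Fin m → A) := by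
    ext l; simp [Finset.sum_apply, Pi.single_apply]
  conv_lhs => rw [hx, hy]
  simp only [map_sum, map_smul, LinearMap.sum_apply, LinearMap.smul_apply, Finset.sum_apply,
    Pi.smul_apply, smul_eq_mul, Finset.mul_sum]
  rw [Finset.sum_comm]
  exact Finset.sum_congr rfl fun i _ => Finset.sum_congr rfl fun j _ => mul_left_comm _ _ _

theorem red_bilin (pr : A →ₐ[K] K) (B₀ : (Fin m → K) →ₗ[K] (Fin m → K) →ₗ[K] (Fin m → K))
    (B : (Fin m → A) →ₗ[A] (Fin m → A) →ₗ[A] (Fin m → A))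
    (h : ∀ i j k, pr (B (Pi.single i 1) (Pi.single j 1) k)
      = B₀ (Pi.single i 1) (Pi.single j 1) k) (x y : Fin m → A) :
    red m pr (B x y) = B₀ (red m pr x) (red m pr y) := by
  funext k
  rw [bilin_expand B₀]
  simp only [red]
  rw [bilin_expand B]
  simp [h]

theorem isUnit_one_add [IsLocalRing A] (pr : A →ₐ[K] K)
    (hpr : ∀ a : A, a ∈ IsLocalRing.maximalIdeal A ↔ pr a = 0)
    (f : Module.End A (Fin m → A)) (hf : ∀ x, red m pr (f x) = 0) : IsUnit (1 + f) := by
  rw [LinearMap.isUnit_iff_isUnit_det, ← LinearMap.det_toMatrix']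
  by_contra hn
  have h1 := (hpr _).1 ((IsLocalRing.mem_maximalIdeal _).2 hn)
  have h2 : pr (LinearMap.toMatrix' (1 + f)).det
      = ((pr : A →+* K).mapMatrix (LinearMap.toMatrix' (1 + f))).det := by
    rw [← RingHom.map_det]; rfl
  have h3 : (pr : A →+* K).mapMatrix (LinearMap.toMatrix' (1 + f)) = 1 := by
    ext i j
    have := congrFun (hf (Pi.single j 1)) i
    simp only [red, Pi.zero_apply] at this
    simp [LinearMap.toMatrix'_apply, Matrix.one_apply, this, Pi.single_apply, apply_ite pr]
  rw [h2, h3, Matrix.det_one] at h1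
  exact one_ne_zero h1

/-- Conjugation of a deformation. -/
theorem isDef_conj (φ₀ : (Fin m → K) → (Fin m → K) → (Fin m → K)) (hbil : IsBilin K φ₀)
    (pr : A →ₐ[K] K) (ψ : (Fin m → A) → (Fin m → A) → (Fin m → A)) (hψ : IsDef φ₀ A pr ψ)
    (g u : Module.End A (Fin m → A)) (hgu : ∀ x, g (u x) = x)
    (hg : ∀ x, red m pr (g x) = red m pr x) :
    IsDef φ₀ A pr (fun x y => u (ψ (g x) (g y))) := by
  obtain ⟨hb, ha, hj, hr⟩ := hψ
  obtain ⟨B, hB⟩ := hb.exists_bilin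
  obtain ⟨B₀, hB₀⟩ := hbil.exists_bilin
  have hu : ∀ x, red m pr (u x) = red m pr x := fun x => by rw [← hg, hgu]
  refine ⟨?_, ?_, ?_, ?_⟩
  · constructor <;> intros <;> simp only [← hB, map_add, map_smul, LinearMap.add_apply,
        LinearMap.smul_apply]
  · intro x; simp [ha]
  · intro x y z
    simp only [hgu, ← map_add, hj, map_zero]
  · intro i j k
    have h1 := red_bilin pr B₀ B (fun i j k => by rw [hB, hB₀]; exact hr i j k)
      (g (Pi.single i 1)) (g (Pi.single j 1))
    rw [← hu, hg, hg, hB, hB₀] at h1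
    have h2 : ∀ i : Fin m, red m pr (Pi.single i 1) = Pi.single i 1 := by
      intro i; funext l; simp [red, Pi.single_apply, apply_ite pr]
    rw [h2, h2] at h1
    exact congrFun h1 k

theorem key_estimate [IsLocalRing A] (pr : A →ₐ[K] K)
    (hpr : ∀ a : A, a ∈ IsLocalRing.maximalIdeal A ↔ pr a = 0)
    (B₀ : (Fin m → K) →ₗ[K] (Fin m → K) →ₗ[K] (Fin m → K))
    (C ψ φ φ' : (Fin m → A) →ₗ[A] (Fin m → A) →ₗ[A] (Fin m → A))
    (hC : ∀ x y, red m pr (C x y) = B₀ (red m pr x) (red m pr y))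
    (hψ : ∀ x y, red m pr (ψ x y) = B₀ (red m pr x) (red m pr y))
    (hφ : ∀ x y, red m pr (φ x y) = B₀ (red m pr x) (red m pr y))
    (w w' : Module.End A (Fin m → A)) (hw : ∀ x, red m pr (w x) = 0)
    (hw' : ∀ x, red m pr (w' x) = 0)
    (h : ∀ x y, ψ (x + w x) (y + w y) = φ x y + w (φ x y))
    (h' : ∀ x y, ψ (x + w' x) (y + w' y) = φ' x y + w' (φ' x y))
    (I : Ideal A) (hI : I ≤ IsLocalRing.maximalIdeal A)
    (hδ : ∀ x, (w' - w) x ∈ vecIn m I) (x y : Fin m → A) :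
    φ' x y - φ x y - (C x ((w' - w) y) + C ((w' - w) x) y - (w' - w) (C x y))
      ∈ vecIn m (IsLocalRing.maximalIdeal A * I) := by
  set 𝔪 := IsLocalRing.maximalIdeal A with h𝔪
  set δ := w' - w with hδdef
  have hwx : ∀ x, w' x = w x + δ x := fun x => by simp [hδdef]
  have hred := mem_vecIn_iff_red (m := m) pr hpr
  have hδ0 : ∀ x, red m pr (δ x) = 0 := fun x => by
    rw [hδdef, LinearMap.sub_apply, red_sub, hw, hw', sub_zero]
  -- the exact expansion
  have hX : (φ' x y - φ x y) + w' (φ' x y - φ x y)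
      = ψ (δ x) (y + w y) + ψ (x + w x) (δ y) + ψ (δ x) (δ y) - δ (φ x y) := by
    have e1 := h' x y
    have e2 := h x y
    have e3 : ψ (x + w' x) (y + w' y) = ψ (x + w x) (y + w y) + ψ (δ x) (y + w y)
        + ψ (x + w x) (δ y) + ψ (δ x) (δ y) := by
      simp only [hwx, map_add, LinearMap.add_apply]
      abel
    have e4 : w' (φ x y) = w (φ x y) + δ (φ x y) := hwx _
    rw [map_sub, e4]
    rw [e1, e2] at e3
    have e5 : φ' x y = φ x y + w (φ x y) + ψ (δ x) (y + w y) + ψ (x + w x) (δ y)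
      + ψ (δ x) (δ y) - w' (φ' x y) := by rw [← e3]; abel
    nth_rewrite 1 [e5]
    abel
  have t1 : ψ (δ x) (y + w y) - C (δ x) y ∈ vecIn m (𝔪 * I) := by
    refine lin_mem (ψ.flip (y + w y) - C.flip y) (fun z => (hred _).2 ?_) (hδ x)
    simp [red_sub, hC, hψ, red_add, hw]
  have t2 : ψ (x + w x) (δ y) - C x (δ y) ∈ vecIn m (𝔪 * I) := by
    refine lin_mem (ψ (x + w x) - C x) (fun z => (hred _).2 ?_) (hδ y)
    simp [red_sub, hC, hψ, red_add, hw]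
  have t3 : ψ (δ x) (δ y) ∈ vecIn m (𝔪 * I) := by
    refine lin_mem (ψ (δ x)) (fun z => (hred _).2 ?_) (hδ y)
    simp [hψ, hδ0]
  have t4 : δ (φ x y) - δ (C x y) ∈ vecIn m (𝔪 * I) := by
    rw [← map_sub, mul_comm]
    refine lin_mem δ hδ ((hred _).2 ?_)
    simp [red_sub, hC, hφ]
  have hXI : (φ' x y - φ x y) + w' (φ' x y - φ x y) ∈ vecIn m I := by
    rw [hX]
    exact Submodule.sub_mem _ (Submodule.add_mem _ (Submodule.add_mem _
      (lin_mem_top (ψ.flip (y + w y)) (hδ x)) (lin_mem_top _ (hδ y)))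
      (lin_mem_top _ (hδ y))) (hδ _)
  obtain ⟨u, hu⟩ := isUnit_one_add pr hpr w' hw'
  have hdI : φ' x y - φ x y ∈ vecIn m I := by
    have := lin_mem_top (u⁻¹).1 hXI
    have e : (φ' x y - φ x y) + w' (φ' x y - φ x y) = u.1 (φ' x y - φ x y) := by
      rw [hu]; simp
    rw [e, ← Module.End.mul_apply, Units.inv_mul] at this
    simpa using this
  have t5 : w' (φ' x y - φ x y) ∈ vecIn m (𝔪 * I) :=
    lin_mem w' (fun z => (hred _).2 (hw' z)) hdI
  have e : φ' x y - φ x y - (C x (δ y) + C (δ x) y - δ (C x y))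
      = (ψ (δ x) (y + w y) - C (δ x) y) + (ψ (x + w x) (δ y) - C x (δ y)) + ψ (δ x) (δ y)
        - (δ (φ x y) - δ (C x y)) - w' (φ' x y - φ x y) := by
    nth_rewrite 1 [eq_sub_of_add_eq hX]
    abel
  rw [e]
  exact Submodule.sub_mem _ (Submodule.sub_mem _ (Submodule.add_mem _ (Submodule.add_mem _ t1 t2) t3)
    t4) t5

theorem exists_baseChange (A : Type) [CommRing A] [Algebra K A]
    (B₀ : (Fin m → K) →ₗ[K] (Fin m → K) →ₗ[K] (Fin m → K)) :
    ∃ C : (Fin m → A) →ₗ[A] (Fin m → A) →ₗ[A] (Fin m → A), ∀ (x y : Fin m → K) (k : Fin m),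
      C (fun i => algebraMap K A (x i)) (fun i => algebraMap K A (y i)) k
        = algebraMap K A (B₀ x y k) := by
  have hb : IsBilin A (fun (x y : Fin m → A) (k : Fin m) =>
      ∑ i, ∑ j, x i * (y j * algebraMap K A (B₀ (Pi.single i 1) (Pi.single j 1) k))) := by
    constructor
    · intro a x x' y
      ext k
      simp [add_mul, Finset.sum_add_distrib, Finset.mul_sum, mul_assoc]
    · intro a x y y'
      ext k
      simp [add_mul, mul_add, Finset.sum_add_distrib, Finset.mul_sum, mul_assoc, mul_left_comm]
  obtain ⟨C, hC⟩ := hb.exists_bilin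
  refine ⟨C, fun x y k => ?_⟩
  rw [hC, bilin_expand B₀]
  simp

end red

/-- For `𝒜` admissible at `φ₀`, `W¹` a complement of
`Z¹(g,g) = Der(g)` in `End_K(V)` and `A` a Noetherian complete local `K`-algebra with
residue field `K`, the map `F(w,φ) = (id+w)∘φ∘((id+w)⁻¹×(id+w)⁻¹)` is a bijection
from `(𝔪⊗W¹) × Def_𝒜(φ₀,A)` onto `Def(φ₀,A)`.  (The relation `F(w,φ) = ψ` is stated
in the inverse-free form `ψ((id+w)x, (id+w)y) = (id+w)(φ(x,y))`.) -/
theorem stmt_3 {K : Type} [Field K] [CharZero K] [IsAlgClosed K] {m : ℕ}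
    (φ₀ : (Fin m → K) → (Fin m → K) → (Fin m → K))
    (hbil : IsBilin K φ₀) (halt : ∀ x, φ₀ x x = 0)
    (hjac : ∀ x y z, φ₀ (φ₀ x y) z + φ₀ (φ₀ y z) x + φ₀ (φ₀ z x) y = 0)
    -- the admissible set 𝒜
    (𝒜 : Set (Fin m × Fin m × Fin m))
    (h𝒜 : ∀ α ∈ 𝒜, α.1 < α.2.1)
    (hadm1 : ∀ ψ : (Fin m → K) → (Fin m → K) → (Fin m → K),
      IsBilin K ψ → (∀ x, ψ x x = 0) →
      ∃ v ∈ Submodule.span K {f | ∃ i j k : Fin m, i < j ∧ (i, j, k) ∉ 𝒜 ∧ f = ekij i j k},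
        ∃ L, IsLin K L ∧ ψ = v + cob φ₀ L)
    (hadm2 : ∀ v ∈ Submodule.span K
        {f | ∃ i j k : Fin m, i < j ∧ (i, j, k) ∉ 𝒜 ∧ f = ekij (K := K) i j k},
      ∀ L, IsLin K L → v = cob φ₀ L → v = 0)
    -- `W¹`: a linear complement of `Z¹(g,g) = Der(g)` in `End_K(V)`
    (W1 : Submodule K ((Fin m → K) → (Fin m → K)))
    (hW1lin : ∀ L ∈ W1, IsLin K L)
    (hW1a : ∀ L : (Fin m → K) → (Fin m → K), IsLin K L →
      ∃ d, (IsLin K d ∧ ∀ x y, d (φ₀ x y) = φ₀ (d x) y + φ₀ x (d y)) ∧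
        ∃ w ∈ W1, L = d + w)
    (hW1b : ∀ w ∈ W1, (∀ x y, w (φ₀ x y) = φ₀ (w x) y + φ₀ x (w y)) → w = 0)
    -- `A`: a Noetherian complete local `K`-algebra with residue field `K`
    (A : Type) [CommRing A] [Algebra K A] [IsLocalRing A] [IsNoetherianRing A]
    (hcomplete : IsAdicComplete (IsLocalRing.maximalIdeal A) A)
    (pr : A →ₐ[K] K)
    (hpr : ∀ a : A, a ∈ IsLocalRing.maximalIdeal A ↔ pr a = 0) :
    -- `𝔪 ⊗ W¹`, as a set of matrices over `A`
    ∀ MW1 : Set (Fin m → Fin m → A),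
    (MW1 = (Submodule.span A {M | ∃ t ∈ IsLocalRing.maximalIdeal A, ∃ L ∈ W1,
        M = fun i j : Fin m => t * algebraMap K A (L (Pi.single j 1) i)} :
          Submodule A (Fin m → Fin m → A))) →
    -- conclusion: `F` is a bijection from `(𝔪⊗W¹) × Def_𝒜(φ₀,A)` onto `Def(φ₀,A)`
    ((∀ W ∈ MW1, ∀ φ : (Fin m → A) → (Fin m → A) → (Fin m → A),
        IsDef φ₀ A pr φ →
        (∀ α ∈ 𝒜, φ (Pi.single α.1 1) (Pi.single α.2.1 1) α.2.2
          = algebraMap K A (φ₀ (Pi.single α.1 1) (Pi.single α.2.1 1) α.2.2)) →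
        ∃ ψ, IsDef φ₀ A pr ψ ∧
          ∀ x y, ψ (matMap W x) (matMap W y) = matMap W (φ x y)) ∧
      (∀ ψ, IsDef φ₀ A pr ψ →
        ∃! Wφ : (Fin m → Fin m → A) × ((Fin m → A) → (Fin m → A) → (Fin m → A)),
          Wφ.1 ∈ MW1 ∧ IsDef φ₀ A pr Wφ.2 ∧
          (∀ α ∈ 𝒜, Wφ.2 (Pi.single α.1 1) (Pi.single α.2.1 1) α.2.2
            = algebraMap K A (φ₀ (Pi.single α.1 1) (Pi.single α.2.1 1) α.2.2)) ∧
          ∀ x y, ψ (matMap Wφ.1 x) (matMap Wφ.1 y) = matMap Wφ.1 (Wφ.2 x y))) := by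
  classical
  intro MW1 hMW1
  haveI : Fintype 𝒜 := Fintype.ofFinite _
  obtain ⟨w, hwW, hdual, hgen⟩ := exists_dual_basis φ₀ hbil halt 𝒜 h𝒜 hadm1 hadm2 W1 hW1lin hW1a hW1b
  obtain ⟨B₀, hB₀⟩ := hbil.exists_bilin
  have hneg := alt_neg B₀ (fun x => by rw [hB₀, halt])
  obtain ⟨C, hC⟩ := exists_baseChange A B₀
  set 𝔪 := IsLocalRing.maximalIdeal A with h𝔪
  let M : 𝒜 → Fin m → Fin m → A := fun β i j => algebraMap K A (w β (Pi.single j 1) i)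
  let E : 𝒜 → Module.End A (Fin m → A) := fun β => Matrix.toLin' (Matrix.of (M β))
  let T : (𝒜 → A) → Module.End A (Fin m → A) := fun c => ∑ β, c β • E β
  have hred := mem_vecIn_iff_red (m := m) pr hpr
  have hEapp : ∀ β x k, E β x k = ∑ j, M β k j * x j := by
    intro β x k
    simp [E, Matrix.toLin'_apply, Matrix.mulVec, dotProduct]
  have hTapp : ∀ c x, T c x = ∑ β, c β • E β x := by
    intro c x; simp [T, LinearMap.sum_apply]
  have hmat : ∀ c x, matMap (∑ β, c β • M β) x = x + T c x := by
    intro c x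
    funext k
    simp only [matMap, Pi.add_apply, hTapp, Finset.sum_apply, Pi.smul_apply, smul_eq_mul, hEapp,
      Finset.mul_sum, Finset.sum_mul]
    rw [Finset.sum_comm]
    simp only [mul_assoc]
  have hMW : ∀ W, W ∈ MW1 ↔ ∃ c : 𝒜 → A, (∀ β, c β ∈ 𝔪) ∧ W = ∑ β, c β • M β := by
    intro W
    rw [hMW1]
    constructor
    · intro h
      induction h using Submodule.span_induction with
      | mem x hx =>
        obtain ⟨t, ht, L, hL, rfl⟩ := hx
        obtain ⟨c, hc⟩ := hgen L hL
        refine ⟨fun β => t * algebraMap K A (c β), fun β => 𝔪.mul_mem_right _ ht, ?_⟩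
        funext i j
        simp only [Finset.sum_apply, Pi.smul_apply, smul_eq_mul, M, hc, map_sum, map_mul,
          Finset.mul_sum, mul_assoc]
      | zero => exact ⟨0, fun β => 𝔪.zero_mem, by simp⟩
      | add x y _ _ hx hy =>
        obtain ⟨c, hc, rfl⟩ := hx
        obtain ⟨c', hc', rfl⟩ := hy
        exact ⟨c + c', fun β => 𝔪.add_mem (hc β) (hc' β), by
          simp [add_smul, Finset.sum_add_distrib]⟩
      | smul a x _ hx =>
        obtain ⟨c, hc, rfl⟩ := hx
        exact ⟨a • c, fun β => 𝔪.mul_mem_left _ (hc β), by simp [Finset.smul_sum, mul_smul]⟩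
    · rintro ⟨c, hc, rfl⟩
      refine Submodule.sum_mem _ fun β _ => Submodule.subset_span ⟨c β, hc β, w β, hwW β, ?_⟩
      rfl
  have hTI : ∀ (I : Ideal A) (c : 𝒜 → A), (∀ β, c β ∈ I) → ∀ x, T c x ∈ vecIn m I := by
    intro I c hc x
    rw [hTapp]
    exact Submodule.sum_mem _ fun β _ => mem_vecIn.2 fun k => I.mul_mem_right _ (hc β)
  have hTred : ∀ c : 𝒜 → A, (∀ β, c β ∈ 𝔪) → ∀ x, red m pr (T c x) = 0 :=
    fun c hc x => (hred _).1 (hTI 𝔪 c hc x)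
  have hTsub : ∀ c c', T c' - T c = T (c' - c) := by
    intro c c'
    refine LinearMap.ext fun x => ?_
    rw [LinearMap.sub_apply, hTapp, hTapp, hTapp]
    simp only [Pi.sub_apply, sub_smul, Finset.sum_sub_distrib]
  have hEalg : ∀ β (x : Fin m → K), E β (fun i => algebraMap K A (x i))
      = fun i => algebraMap K A (w β x i) := by
    intro β x
    funext k
    obtain ⟨l, hl⟩ := (hW1lin _ (hwW β)).exists_lin
    have hx : x = ∑ i, x i • (Pi.single i 1 : Fin m → K) := by
      ext l; simp [Finset.sum_apply, Pi.single_apply]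
    rw [hEapp]
    conv_rhs => rw [hx]
    simp only [M, ← hl, map_sum, map_smul, Finset.sum_apply, Pi.smul_apply, smul_eq_mul, map_mul]
    exact Finset.sum_congr rfl fun i _ => mul_comm _ _
  have hsingle : ∀ i : Fin m, (Pi.single i 1 : Fin m → A)
      = fun l => algebraMap K A ((Pi.single i 1 : Fin m → K) l) := by
    intro i; funext l; simp [Pi.single_apply, apply_ite (algebraMap K A)]
  have hC' : ∀ x y : Fin m → K, C (fun i => algebraMap K A (x i)) (fun i => algebraMap K A (y i))
      = fun k => algebraMap K A (B₀ x y k) := fun x y => funext (hC x y)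
  have hTd : ∀ (c : 𝒜 → A) (α : 𝒜),
      (C (Pi.single α.1.1 1) (T c (Pi.single α.1.2.1 1))
        + C (T c (Pi.single α.1.1 1)) (Pi.single α.1.2.1 1)
        - T c (C (Pi.single α.1.1 1) (Pi.single α.1.2.1 1))) α.1.2.2 = c α := by
    intro c α
    have h1 : ∀ β, (C (Pi.single α.1.1 1) (E β (Pi.single α.1.2.1 1))
        + C (E β (Pi.single α.1.1 1)) (Pi.single α.1.2.1 1)
        - E β (C (Pi.single α.1.1 1) (Pi.single α.1.2.1 1))) α.1.2.2
        = if α = β then 1 else 0 := by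
      intro β
      have h2 := hdual α β
      simp only [cob, ← hB₀] at h2
      rw [hneg (Pi.single α.1.2.1 1), sub_neg_eq_add] at h2
      rw [hsingle, hsingle]
      simp only [hEalg, hC', Pi.add_apply, Pi.sub_apply, ← map_add, ← map_sub]
      simp only [Pi.add_apply, Pi.sub_apply] at h2
      rw [h2]
      split_ifs <;> simp
    have h3 : C (Pi.single α.1.1 1) (T c (Pi.single α.1.2.1 1))
        + C (T c (Pi.single α.1.1 1)) (Pi.single α.1.2.1 1)
        - T c (C (Pi.single α.1.1 1) (Pi.single α.1.2.1 1))
        = ∑ β, c β • (C (Pi.single α.1.1 1) (E β (Pi.single α.1.2.1 1))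
        + C (E β (Pi.single α.1.1 1)) (Pi.single α.1.2.1 1)
        - E β (C (Pi.single α.1.1 1) (Pi.single α.1.2.1 1))) := by
      simp only [hTapp, map_sum, map_smul, LinearMap.sum_apply, LinearMap.smul_apply, smul_sub,
        smul_add, Finset.sum_sub_distrib, Finset.sum_add_distrib]
    rw [h3]
    simp only [Finset.sum_apply, Pi.smul_apply, smul_eq_mul, h1]
    simp
  -- the inverse of `1 + T c`
  let S : (𝒜 → A) → Module.End A (Fin m → A) := fun c => Ring.inverse (1 + T c)
  have hS1 : ∀ c : 𝒜 → A, (∀ β, c β ∈ 𝔪) → ∀ x, (1 + T c) (S c x) = x := by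
    intro c hc x
    rw [← Module.End.mul_apply, Ring.mul_inverse_cancel _ (isUnit_one_add pr hpr _ (hTred c hc))]
    rfl
  have hS2 : ∀ c : 𝒜 → A, (∀ β, c β ∈ 𝔪) → ∀ x, S c ((1 + T c) x) = x := by
    intro c hc x
    rw [← Module.End.mul_apply, Ring.inverse_mul_cancel _ (isUnit_one_add pr hpr _ (hTred c hc))]
    rfl
  have hg : ∀ c : 𝒜 → A, (∀ β, c β ∈ 𝔪) → ∀ x, red m pr ((1 + T c) x) = red m pr x := by
    intro c hc x
    simp [red_add, hTred c hc]
  have hg1 : ∀ c x, matMap (∑ β, c β • M β) x = (1 + T c) x := by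
    intro c x; rw [hmat]; simp
  have hredB : ∀ f, IsDef φ₀ A pr f → ∃ B : (Fin m → A) →ₗ[A] (Fin m → A) →ₗ[A] (Fin m → A),
      (∀ x y, B x y = f x y) ∧ ∀ x y, red m pr (B x y) = B₀ (red m pr x) (red m pr y) := by
    intro f hf
    obtain ⟨B, hB⟩ := hf.1.exists_bilin
    exact ⟨B, hB, red_bilin pr B₀ B fun i j k => by rw [hB, hB₀]; exact hf.2.2.2 i j k⟩
  refine ⟨?_, ?_⟩
  · intro W hW φ hφ _
    obtain ⟨c, hc, rfl⟩ := (hMW W).1 hW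
    refine ⟨_, isDef_conj φ₀ hbil pr φ hφ (S c) (1 + T c) (hS2 c hc) ?_, ?_⟩
    · intro x
      rw [← hg c hc, hS1 c hc]
    · intro x y
      simp only [hg1, hS2 c hc]
  · intro ψ hψ
    obtain ⟨Bψ, hBψ, hrψ⟩ := hredB ψ hψ
    let φc : (𝒜 → A) → (Fin m → A) → (Fin m → A) → (Fin m → A) :=
      fun c x y => S c (ψ ((1 + T c) x) ((1 + T c) y))
    have hφc : ∀ c : 𝒜 → A, (∀ β, c β ∈ 𝔪) → IsDef φ₀ A pr (φc c) := fun c hc =>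
      isDef_conj φ₀ hbil pr ψ hψ (1 + T c) (S c) (hS1 c hc) (hg c hc)
    let F : (𝒜 → A) → 𝒜 → A := fun c α => c α
      - (φc c (Pi.single α.1.1 1) (Pi.single α.1.2.1 1) α.1.2.2
        - algebraMap K A (φ₀ (Pi.single α.1.1 1) (Pi.single α.1.2.1 1) α.1.2.2))
    have hfix : ∀ c, F c = c ↔ ∀ α ∈ 𝒜, φc c (Pi.single α.1 1) (Pi.single α.2.1 1) α.2.2
          = algebraMap K A (φ₀ (Pi.single α.1 1) (Pi.single α.2.1 1) α.2.2) := by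
      intro c
      rw [funext_iff]
      simp only [F, sub_eq_self, sub_eq_zero, Subtype.forall]
    have hrC : ∀ x y, red m pr (C x y) = B₀ (red m pr x) (red m pr y) := by
      apply red_bilin
      intro i j k
      rw [hsingle, hsingle, hC']
      simp
    obtain ⟨⟨c, hcm, hcF⟩, huniq⟩ := contraction 𝔪 hcomplete F (by
        intro c hc α
        refine 𝔪.sub_mem (hc α) ((hpr _).2 ?_)
        rw [map_sub, (hφc c hc).2.2.2]
        simp) (by
        intro n c c' hc hc' hd α
        obtain ⟨P, hP, hrP⟩ := hredB _ (hφc c hc)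
        obtain ⟨P', hP', hrP'⟩ := hredB _ (hφc c' hc')
        have h1 := key_estimate pr hpr B₀ C Bψ P P' hrC hrψ hrP (T c) (T c') (hTred c hc)
          (hTred c' hc')
          (by
            intro x y
            have := hS1 c hc (ψ ((1 + T c) x) ((1 + T c) y))
            rw [hP, hBψ]
            simpa [φc] using this.symm)
          (by
            intro x y
            have := hS1 c' hc' (ψ ((1 + T c') x) ((1 + T c') y))
            rw [hP', hBψ]
            simpa [φc] using this.symm)
          (𝔪 ^ (n + 1)) (Ideal.pow_le_self (by omega))
          (by
            rw [hTsub]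
            exact hTI _ _ hd) (Pi.single α.1.1 1) (Pi.single α.1.2.1 1)
        have h2 := mem_vecIn.1 h1 α.1.2.2
        rw [hTsub, Pi.sub_apply, hTd, hP, hP', ← h𝔪, ← pow_succ'] at h2
        have h3 := neg_mem h2
        convert h3 using 1
        simp only [F, Pi.sub_apply]
        ring)
    refine ⟨(∑ β, c β • M β, φc c), ⟨(hMW _).2 ⟨c, hcm, rfl⟩, hφc c hcm, (hfix c).1 hcF, ?_⟩, ?_⟩
    · intro x y
      simp only [hg1]
      exact (hS1 c hcm _).symm
    · rintro ⟨W, φ⟩ ⟨hW, hφ, hφA, heq⟩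
      simp only at hW hφ hφA heq
      obtain ⟨c', hc', rfl⟩ := (hMW W).1 hW
      have e : φ = φc c' := by
        funext x y
        have := heq x y
        simp only [hg1] at this
        simp only [φc]
        rw [this, hS2 c' hc']
      subst e
      have := huniq c c' hcm hc' hcF ((hfix c').2 hφA)
      subst this
      rfl

end Stmt3
end
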